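/- arXiv:2110.08210 — 4 statements merged into one kernel-verified Lean document; each statement's English description precedes it below -/
import Mathlib

section
/- First fundamental theorem for GL(n,ℂ) (Procesi): let j, n ≥ 1 and let P be a polynomial in the entries of j generic n×n complex matrices that is invariant under simultaneous conjugation, i.e. for every invertible matrix g ∈ GL(n,ℂ) and every tuple x : Fin j → Matrix (Fin n) (Fin n) ℂ, the evaluation of P at (i ↦ g · (x i) · g⁻¹) equals its evaluation at x. Then P lies in the ℂ-subalgebra of MvPolynomial (Fin j × Fin n × Fin n) ℂ generated by the word-trace polynomials, i.e. the polynomials whose evaluation at x equals Tr(x_{i₁} · x_{i₂} ⋯ x_{i_s}) for some finite nonempty sequence of indices i₁, …, i_s ∈ Fin j. -/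
open Matrix

namespace FFT

/-- exponent vector of the monomial attached to a sequence of variables -/
noncomputable def mono {ι : Type*} {m : ℕ} (u : Fin m → ι) : ι →₀ ℕ :=
  ∑ k, Finsupp.single (u k) 1

lemma prod_X_eq {ι : Type*} {m : ℕ} (u : Fin m → ι) :
    (∏ k, MvPolynomial.X (u k) : MvPolynomial ι ℂ) = MvPolynomial.monomial (mono u) 1 := by
  classical
  unfold mono
  rw [MvPolynomial.monomial_sum_one]
  rfl

lemma mono_comp {ι : Type*} {m : ℕ} (u : Fin m → ι) (σ : Equiv.Perm (Fin m)) :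
    mono (fun k => u (σ k)) = mono u := by
  unfold mono
  exact Equiv.sum_comp σ (fun k => Finsupp.single (u k) 1)

lemma mono_eq_imp {ι : Type*} {m : ℕ} (u v : Fin m → ι) (h : mono u = mono v) :
    ∃ σ : Equiv.Perm (Fin m), ∀ k, v (σ k) = u k := by
  classical
  have key : ∀ (w : Fin m → ι) (s : ι), mono w s = Fintype.card {k // w k = s} := by
    intro w s
    simp [mono, Finsupp.finsetSum_apply, Finsupp.single_apply, Fintype.card_subtype]
  have e : ∀ s, Nonempty ({k // u k = s} ≃ {k // v k = s}) := by
    intro s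
    rw [← Fintype.card_eq, ← key, ← key, h]
  exact ⟨Equiv.ofFiberEquiv (fun s => (e s).some), fun k => Equiv.ofFiberEquiv_map _ k⟩

lemma sum_get {ι : Type*} (l : List ι) :
    ∑ x : Fin l.length, ({l.get x} : Multiset ι) = (l : Multiset ι) := by
  induction l with
  | nil => simp
  | cons a l ih =>
    have h := Fin.sum_univ_succ (fun x : Fin (l.length + 1) => ({(a :: l).get x} : Multiset ι))
    refine h.trans ?_
    change ({a} : Multiset ι) + ∑ x : Fin l.length, ({l.get x} : Multiset ι) = _
    rw [ih]
    rfl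

lemma exists_mono {ι : Type*} {m : ℕ} (d : ι →₀ ℕ) (hd : d.degree = m) :
    ∃ u : Fin m → ι, mono u = d := by
  classical
  obtain ⟨l, hl⟩ := Quot.exists_rep (Finsupp.toMultiset d)
  have hl' : (l : Multiset ι) = Finsupp.toMultiset d := hl
  have hlen : l.length = m := by
    rw [← hd, ← Multiset.coe_card, hl', Finsupp.card_toMultiset]; rfl
  subst hlen
  refine ⟨l.get, ?_⟩
  apply Multiset.toFinsupp.symm.injective
  change Finsupp.toMultiset _ = Finsupp.toMultiset _
  rw [← hl']
  unfold mono
  rw [map_sum]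
  simp only [Finsupp.toMultiset_single, one_smul]
  exact sum_get l

lemma coeff_sum {ι : Type*} {m : ℕ} [Fintype ι] [DecidableEq ι] (c : (Fin m → ι) → ℂ) (d : ι →₀ ℕ) :
    MvPolynomial.coeff d (∑ u, MvPolynomial.C (c u) * ∏ k, MvPolynomial.X (u k)) =
      ∑ u, if mono u = d then c u else 0 := by
  simp only [prod_X_eq, MvPolynomial.coeff_sum, MvPolynomial.coeff_C_mul,
    MvPolynomial.coeff_monomial, mul_ite, mul_one, mul_zero]

lemma symm_unique {ι : Type*} {m : ℕ} [Fintype ι] [DecidableEq ι] (c c' : (Fin m → ι) → ℂ)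
    (hc : ∀ (σ : Equiv.Perm (Fin m)) u, c (fun k => u (σ k)) = c u)
    (hc' : ∀ (σ : Equiv.Perm (Fin m)) u, c' (fun k => u (σ k)) = c' u)
    (h : (∑ u, MvPolynomial.C (c u) * ∏ k, MvPolynomial.X (u k) : MvPolynomial ι ℂ) =
      ∑ u, MvPolynomial.C (c' u) * ∏ k, MvPolynomial.X (u k)) (u : Fin m → ι) : c u = c' u := by
  have key : ∀ c : (Fin m → ι) → ℂ,
      (∀ (σ : Equiv.Perm (Fin m)) u, c (fun k => u (σ k)) = c u) →
      (∑ v, if mono v = mono u then c v else 0) =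
        ((Finset.univ.filter fun v : Fin m → ι => mono v = mono u).card : ℂ) * c u := by
    intro c hc
    rw [← Finset.sum_filter, ← nsmul_eq_mul]
    apply Finset.sum_eq_card_nsmul
    intro v hv
    obtain ⟨σ, hσ⟩ := mono_eq_imp v u (by simpa using hv)
    rw [← hc σ u]
    congr 1
    exact (funext hσ).symm
  have h1 := congrArg (MvPolynomial.coeff (mono u)) h
  rw [coeff_sum, coeff_sum, key c hc, key c' hc'] at h1
  refine mul_left_cancel₀ ?_ h1
  rw [Nat.cast_ne_zero]
  apply Finset.card_ne_zero_of_mem (a := u)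
  simp

lemma exists_symm {ι : Type*} {m : ℕ} [Fintype ι] [DecidableEq ι] (Q : MvPolynomial ι ℂ)
    (hQ : Q.IsHomogeneous m) :
    ∃ c : (Fin m → ι) → ℂ, (∀ (σ : Equiv.Perm (Fin m)) u, c (fun k => u (σ k)) = c u) ∧
      Q = ∑ u, MvPolynomial.C (c u) * ∏ k, MvPolynomial.X (u k) := by
  refine ⟨fun u => MvPolynomial.coeff (mono u) Q /
    ((Finset.univ.filter fun v : Fin m → ι => mono v = mono u).card : ℂ), ?_, ?_⟩
  · intro σ u
    simp only [mono_comp]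
  · ext d
    rw [coeff_sum, ← Finset.sum_filter]
    rw [Finset.sum_congr rfl (g := fun _ => MvPolynomial.coeff d Q /
      ((Finset.univ.filter fun v : Fin m → ι => mono v = d).card : ℂ))]
    · rw [Finset.sum_const, nsmul_eq_mul]
      by_cases hd : d.degree = m
      · obtain ⟨u, hu⟩ := exists_mono d hd
        rw [mul_div_cancel₀]
        rw [Nat.cast_ne_zero]
        apply Finset.card_ne_zero_of_mem (a := u)
        simpa using hu
      · rw [hQ.coeff_eq_zero hd]; simp
    · intro u hu
      have : mono u = d := by simpa using hu
      rw [this]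

/-- double centralizer theorem for permutation representations -/
lemma bicomm {G X : Type*} [Group G] [Fintype G] [Fintype X] [DecidableEq X]
    (ρ : G →* Equiv.Perm X) (T : Matrix X X ℂ)
    (hT : ∀ S : Matrix X X ℂ, (∀ g a b, S (ρ g a) (ρ g b) = S a b) → T * S = S * T) :
    T ∈ Submodule.span ℂ (Set.range fun g : G =>
      (Matrix.of fun a b => if a = ρ g b then (1 : ℂ) else 0 : Matrix X X ℂ)) := by
  set N := Submodule.span ℂ (Set.range fun g : G =>
      (Matrix.of fun a b => if a = ρ g b then (1 : ℂ) else 0 : Matrix X X ℂ)) with hN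
  obtain ⟨p, hp⟩ := N.subtype.exists_leftInverse_of_injective (by simp)
  -- left translation
  let L : G → (Matrix X X ℂ →ₗ[ℂ] Matrix X X ℂ) := fun g =>
    { toFun := fun Z => Matrix.of fun a x => Z (ρ g⁻¹ a) x
      map_add' := fun _ _ => rfl
      map_smul' := fun _ _ => rfl }
  have hLmul : ∀ g h Z, L g (L h Z) = L (g * h) Z := by
    intro g h Z
    ext a x
    simp only [L, LinearMap.coe_mk, AddHom.coe_mk, Matrix.of_apply, _root_.mul_inv_rev, map_mul,
      Equiv.Perm.mul_apply]
    rfl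
  have hLN : ∀ g, ∀ Z ∈ N, L g Z ∈ N := by
    intro g Z hZ
    induction hZ using Submodule.span_induction with
    | mem x hx =>
      obtain ⟨h, rfl⟩ := hx
      apply Submodule.subset_span
      refine ⟨g * h, ?_⟩
      ext a b
      simp only [L, LinearMap.coe_mk, AddHom.coe_mk, Matrix.of_apply, map_mul, map_inv,
        Equiv.Perm.mul_apply, Equiv.Perm.inv_eq_iff_eq]
    | zero => simp
    | add x y _ _ hx hy => rw [map_add]; exact N.add_mem hx hy
    | smul c x _ hx => rw [map_smul]; exact N.smul_mem c hx
  let π : Matrix X X ℂ →ₗ[ℂ] Matrix X X ℂ :=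
    (Fintype.card G : ℂ)⁻¹ • ∑ g : G, (L g⁻¹) ∘ₗ N.subtype ∘ₗ p ∘ₗ (L g)
  have hπ : ∀ Z, π Z = (Fintype.card G : ℂ)⁻¹ • ∑ g : G, L g⁻¹ (p (L g Z) : Matrix X X ℂ) := by
    intro Z
    simp [π, LinearMap.sum_apply]
  have hπN : ∀ Z, π Z ∈ N := by
    intro Z
    rw [hπ]
    exact N.smul_mem _ (N.sum_mem fun g _ => hLN _ _ (p _).2)
  have hπid : ∀ Z ∈ N, π Z = Z := by
    intro Z hZ
    have h1 : ∀ g : G, L g⁻¹ (p (L g Z) : Matrix X X ℂ) = Z := by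
      intro g
      have := LinearMap.congr_fun hp ⟨L g Z, hLN g Z hZ⟩
      simp only [LinearMap.comp_apply, Submodule.subtype_apply, LinearMap.id_apply] at this
      rw [this]
      simp only [hLmul]
      ext a x
      simp only [L, LinearMap.coe_mk, AddHom.coe_mk, Matrix.of_apply, inv_mul_cancel, inv_one,
        map_one, Equiv.Perm.one_apply]
    rw [hπ]
    simp only [h1]
    rw [Finset.sum_const, Finset.card_univ, ← Nat.cast_smul_eq_nsmul ℂ, smul_smul,
      inv_mul_cancel₀ (by simp), one_smul]
  have hπL : ∀ g Z, π (L g Z) = L g (π Z) := by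
    intro g Z
    rw [hπ, hπ, map_smul, map_sum]
    congr 1
    simp only [hLmul]
    rw [← Equiv.sum_comp (Equiv.mulRight g) (fun x => L (g * x⁻¹) (p (L x Z) : Matrix X X ℂ))]
    simp
  -- the blocks of π are invariant
  let S : X → X → Matrix X X ℂ := fun x y => Matrix.of fun a b => π (Matrix.single b y 1) a x
  have hS : ∀ x y, T * S x y = S x y * T := by
    intro x y
    apply hT
    intro g a b
    have : (Matrix.single (ρ g b) y 1 : Matrix X X ℂ) = L g (Matrix.single b y 1) := by
      ext c z
      simp only [L, LinearMap.coe_mk, AddHom.coe_mk, Matrix.of_apply, Matrix.single_apply,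
        map_inv, Equiv.Perm.eq_inv_iff_eq]
    simp only [S, Matrix.of_apply]
    rw [this, hπL]
    simp [L]
  have hexp : ∀ Z a x, π Z a x = ∑ b, ∑ y, Z b y * S x y a b := by
    intro Z a x
    conv_lhs => rw [Matrix.matrix_eq_sum_single Z]
    simp only [map_sum, Matrix.sum_apply, S, Matrix.of_apply]
    refine Finset.sum_congr rfl fun b _ => Finset.sum_congr rfl fun y _ => ?_
    have : (Matrix.single b y (Z b y) : Matrix X X ℂ) = Z b y • Matrix.single b y 1 := by
      simp [Matrix.smul_single]
    rw [this, map_smul]; rfl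
  have hcomm : ∀ Z, T * π Z = π (T * Z) := by
    intro Z
    ext a x
    rw [hexp, Matrix.mul_apply]
    simp only [hexp, Matrix.mul_apply]
    have h2 : ∀ y b, ∑ c, T a c * S x y c b = ∑ c, S x y a c * T c b := by
      intro y b
      have := congrFun (congrFun (hS x y) a) b
      simpa only [Matrix.mul_apply] using this
    calc ∑ c, T a c * ∑ b, ∑ y, Z b y * S x y c b
        = ∑ b, ∑ y, Z b y * ∑ c, T a c * S x y c b := by
          simp only [Finset.mul_sum]
          rw [Finset.sum_comm]
          refine Finset.sum_congr rfl fun b _ => ?_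
          rw [Finset.sum_comm]
          refine Finset.sum_congr rfl fun y _ => Finset.sum_congr rfl fun c _ => ?_
          ring
      _ = ∑ b, ∑ y, Z b y * ∑ c, S x y a c * T c b := by simp only [h2]
      _ = ∑ c, ∑ y, (∑ b, T c b * Z b y) * S x y a c := by
          simp only [Finset.mul_sum, Finset.sum_mul]
          rw [Finset.sum_comm, Finset.sum_comm (s := Finset.univ) (t := Finset.univ) (f := fun c y => ∑ b, T c b * Z b y * S x y a c)]
          refine Finset.sum_congr rfl fun y _ => ?_
          rw [Finset.sum_comm]
          refine Finset.sum_congr rfl fun c _ => Finset.sum_congr rfl fun b _ => ?_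
          ring
  have h1N : (1 : Matrix X X ℂ) ∈ N := by
    apply Submodule.subset_span
    refine ⟨1, ?_⟩
    ext a b
    simp [Matrix.one_apply]
  have := hcomm 1
  rw [hπid 1 h1N, mul_one] at this
  rw [this]
  exact hπN T


lemma trace_mem {R : Type*} [CommRing R] [Algebra ℂ R] {n : ℕ} {J : Type*}
    (M : J → Matrix (Fin n) (Fin n) R) (A : Subalgebra ℂ R)
    (hA : ∀ w : List J, w ≠ [] → Matrix.trace (w.map M).prod ∈ A) (m : ℕ) :
    ∀ (σ : Equiv.Perm (Fin m)) (W : Fin m → List J), (∀ k, W k ≠ []) →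
      ∑ I : Fin m → Fin n, ∏ k, ((W k).map M).prod (I k) (I (σ k)) ∈ A := by
  induction m with
  | zero =>
    intro σ W hW
    simp
  | succ m ih =>
    intro σ W hW
    obtain ⟨⟨p, e⟩, rfl⟩ := Equiv.Perm.decomposeFin.symm.surjective σ
    rw [← (Fin.consEquiv (fun _ => Fin n)).sum_comp, Fintype.sum_prod_type, Finset.sum_comm]
    simp only [Fin.prod_univ_succ, Equiv.Perm.decomposeFin_symm_apply_zero,
      Equiv.Perm.decomposeFin_symm_apply_succ, Fin.consEquiv_apply, Fin.cons_zero, Fin.cons_succ]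
    refine Fin.cases ?_ (fun q => ?_) p
    · simp only [Equiv.swap_self, Equiv.refl_apply, Fin.cons_zero, Fin.cons_succ]
      have : ∑ y : Fin m → Fin n, ∑ x : Fin n, ((W 0).map M).prod x x *
            ∏ k : Fin m, ((W k.succ).map M).prod (y k) (y (e k)) =
          Matrix.trace ((W 0).map M).prod *
            ∑ y : Fin m → Fin n, ∏ k : Fin m, ((W k.succ).map M).prod (y k) (y (e k)) := by
        rw [Finset.mul_sum]
        refine Finset.sum_congr rfl fun y _ => ?_
        rw [← Finset.sum_mul]; rfl
      rw [this]
      exact A.mul_mem (hA _ (hW 0)) (ih e (fun k => W k.succ) fun k => hW _)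
    · obtain ⟨k0, rfl⟩ := e.surjective q
      have := ih e (Function.update (fun k => W k.succ) k0 (W k0.succ ++ W 0)) (by
        intro k
        by_cases h : k = k0
        · subst h; simp [hW]
        · simp [h, hW])
      convert this using 1
      refine Finset.sum_congr rfl fun y _ => ?_
      rw [← Finset.mul_prod_erase Finset.univ _ (Finset.mem_univ k0)]
      rw [Function.update_self, List.map_append, List.prod_append, Matrix.mul_apply,
        Finset.sum_mul]
      refine Finset.sum_congr rfl fun x _ => ?_
      rw [← Finset.mul_prod_erase Finset.univ _ (Finset.mem_univ k0)]
      rw [Equiv.swap_apply_right, Fin.cons_zero, ← mul_assoc]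
      congr 1
      · simp only [Fin.cons_succ]; ring
      · refine Finset.prod_congr rfl fun k hk => ?_
        have hk' : k ≠ k0 := by simpa using hk
        rw [Function.update_of_ne hk', Equiv.swap_apply_of_ne_of_ne (Fin.succ_ne_zero _)]
        · simp only [Fin.cons_succ]
        · simpa using hk'

/-- polynomial identities on GL extend -/
lemma zero_of_GL {n : ℕ} (F : MvPolynomial (Fin n × Fin n) ℂ)
    (h : ∀ g : GL (Fin n) ℂ, MvPolynomial.eval (fun p => (g : Matrix (Fin n) (Fin n) ℂ) p.1 p.2) F = 0) :
    F = 0 := by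
  have : F * Matrix.det (Matrix.mvPolynomialX (Fin n) (Fin n) ℂ) = 0 := by
    apply MvPolynomial.funext
    intro x
    rw [map_mul, map_zero]
    have hdet : MvPolynomial.eval x (Matrix.det (Matrix.mvPolynomialX (Fin n) (Fin n) ℂ)) =
        (Matrix.of fun a b => x (a, b)).det := by
      rw [RingHom.map_det]
      congr 1
      ext a b
      simp [Matrix.mvPolynomialX]
    rw [hdet]
    by_cases hx : (Matrix.of fun a b => x (a, b)).det = 0
    · rw [hx, mul_zero]
    · have := h (Matrix.GeneralLinearGroup.mkOfDetNeZero _ hx)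
      have h2 : MvPolynomial.eval x F = 0 := by
        exact this
      rw [h2, zero_mul]
  exact (mul_eq_zero.mp this).resolve_right (Matrix.det_mvPolynomialX_ne_zero _ _)


/-- place permutation action on multi-indices -/
def rho (m n : ℕ) : Equiv.Perm (Fin m) →* Equiv.Perm (Fin m → Fin n) where
  toFun σ :=
    { toFun := fun I k => I (σ⁻¹ k)
      invFun := fun I k => I (σ k)
      left_inv := fun I => by ext k; simp
      right_inv := fun I => by ext k; simp }
  map_one' := by ext I k; simp
  map_mul' σ τ := by ext I k; simp

lemma rho_apply {m n : ℕ} (σ : Equiv.Perm (Fin m)) (I : Fin m → Fin n) (k : Fin m) :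
    rho m n σ I k = I (σ⁻¹ k) := rfl

lemma schur_weyl {m n : ℕ} (C : Matrix (Fin m → Fin n) (Fin m → Fin n) ℂ)
    (hC : ∀ (g : GL (Fin n) ℂ) A B,
      ∑ I, (∏ k, (g : Matrix (Fin n) (Fin n) ℂ) (I k) (A k)) * C I B =
        ∑ I, C A I * ∏ k, (g : Matrix (Fin n) (Fin n) ℂ) (B k) (I k)) :
    C ∈ Submodule.span ℂ (Set.range fun σ : Equiv.Perm (Fin m) =>
      (Matrix.of fun a b => if a = rho m n σ b then (1 : ℂ) else 0 :
        Matrix (Fin m → Fin n) (Fin m → Fin n) ℂ)) := by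
  classical
  apply bicomm
  intro S hS
  -- polynomial identity
  have hpoly : ∀ A B : Fin m → Fin n,
      (∑ I, C I B • ∏ k, MvPolynomial.X (I k, A k) : MvPolynomial (Fin n × Fin n) ℂ) =
        ∑ I, C A I • ∏ k, MvPolynomial.X (B k, I k) := by
    intro A B
    rw [← sub_eq_zero]
    apply zero_of_GL
    intro g
    have := hC g A B
    simp only [map_sub, map_sum, MvPolynomial.smul_eval, map_prod, MvPolynomial.eval_X]
    rw [sub_eq_zero, ← this]
    exact Finset.sum_congr rfl fun I _ => mul_comm _ _
  -- linear functional
  let f : (Fin n × Fin n →₀ ℕ) → ℂ := fun d =>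
    if h : ∃ u : Fin m → Fin n × Fin n, mono u = d then
      S (fun k => (h.choose k).2) (fun k => (h.choose k).1) else 0
  let L := (MvPolynomial.basisMonomials (Fin n × Fin n) ℂ).constr ℂ f
  have hL : ∀ A I : Fin m → Fin n, L (∏ k, MvPolynomial.X (I k, A k)) = S A I := by
    intro A I
    rw [prod_X_eq (fun k => (I k, A k))]
    have h1 := (MvPolynomial.basisMonomials (Fin n × Fin n) ℂ).constr_basis ℂ f
      (mono (fun k => (I k, A k)))
    rw [MvPolynomial.coe_basisMonomials] at h1
    change L _ = _ at h1
    rw [h1]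
    have hex : ∃ u : Fin m → Fin n × Fin n, mono u = mono (fun k => (I k, A k)) := ⟨_, rfl⟩
    simp only [f, dif_pos hex]
    obtain ⟨σ, hσ⟩ := mono_eq_imp _ _ hex.choose_spec
    rw [← hS σ⁻¹ A I]
    congr 1
    · ext k; rw [← hσ k, rho_apply]; simp
    · ext k; rw [← hσ k, rho_apply]; simp
  ext A B
  have h := congrArg L (hpoly A B)
  simp only [map_sum, map_smul, hL, smul_eq_mul] at h
  rw [Matrix.mul_apply, Matrix.mul_apply, ← h]
  exact Finset.sum_congr rfl fun I _ => mul_comm _ _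

/-- substitution homomorphism for simultaneous conjugation -/
noncomputable def phi (j n : ℕ) (g h : Matrix (Fin n) (Fin n) ℂ) :
    MvPolynomial (Fin j × Fin n × Fin n) ℂ →ₐ[ℂ] MvPolynomial (Fin j × Fin n × Fin n) ℂ :=
  MvPolynomial.aeval fun p => ∑ a, ∑ b,
    MvPolynomial.C (g p.2.1 a * h b p.2.2) * MvPolynomial.X (p.1, a, b)

lemma eval_phi {j n : ℕ} (g h : Matrix (Fin n) (Fin n) ℂ)
    (P : MvPolynomial (Fin j × Fin n × Fin n) ℂ) (x : Fin j × Fin n × Fin n → ℂ) :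
    MvPolynomial.eval x (phi j n g h P) =
      MvPolynomial.eval (fun p => (g * (Matrix.of fun a b => x (p.1, a, b)) * h) p.2.1 p.2.2) P := by
  have : (MvPolynomial.aeval x).comp (phi j n g h) = MvPolynomial.aeval
      (fun p => (g * (Matrix.of fun a b => x (p.1, a, b)) * h) p.2.1 p.2.2) := by
    apply MvPolynomial.algHom_ext
    intro p
    simp only [phi, AlgHom.comp_apply, MvPolynomial.aeval_X, map_sum, map_mul,
      MvPolynomial.aeval_C, Matrix.mul_apply, Matrix.of_apply, Finset.sum_mul]
    rw [Finset.sum_comm]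
    refine Finset.sum_congr rfl fun b _ => Finset.sum_congr rfl fun a _ => ?_
    simp only [Algebra.algebraMap_self, RingHom.id_apply]
    ring
  have := AlgHom.congr_fun this P
  simpa [MvPolynomial.aeval_eq_eval] using this

lemma phi_component {j n : ℕ} (g h : Matrix (Fin n) (Fin n) ℂ)
    (P : MvPolynomial (Fin j × Fin n × Fin n) ℂ) (hP : phi j n g h P = P) (m : ℕ) :
    phi j n g h (MvPolynomial.homogeneousComponent m P) =
      MvPolynomial.homogeneousComponent m P := by
  have hhom : ∀ i, (phi j n g h (MvPolynomial.homogeneousComponent i P)).IsHomogeneous i := by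
    intro i
    have := (MvPolynomial.homogeneousComponent_isHomogeneous i P).aeval (n := 1)
      (fun p : Fin j × Fin n × Fin n => ∑ a, ∑ b,
        MvPolynomial.C (g p.2.1 a * h b p.2.2) * (MvPolynomial.X (p.1, a, b) :
          MvPolynomial (Fin j × Fin n × Fin n) ℂ)) (by
        intro p
        refine MvPolynomial.IsHomogeneous.sum _ _ _ fun a _ =>
          MvPolynomial.IsHomogeneous.sum _ _ _ fun b _ => ?_
        exact (MvPolynomial.isHomogeneous_X _ _).C_mul _)
    rwa [one_mul] at this
  have h1 : MvPolynomial.homogeneousComponent m (phi j n g h P) =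
      phi j n g h (MvPolynomial.homogeneousComponent m P) := by
    conv_lhs => rw [← MvPolynomial.sum_homogeneousComponent P]
    rw [map_sum, map_sum]
    simp only [MvPolynomial.homogeneousComponent_of_mem (hhom _)]
    rw [Finset.sum_ite_eq]
    split_ifs with hm
    · rfl
    · rw [MvPolynomial.homogeneousComponent_eq_zero, map_zero]
      simpa using hm
  rw [← h1, hP]

lemma sum_triple {j n m : ℕ} {R : Type*} [AddCommMonoid R] (F : (Fin m → Fin j × Fin n × Fin n) → R) :
    ∑ u, F u = ∑ w : Fin m → Fin j, ∑ I : Fin m → Fin n, ∑ J : Fin m → Fin n,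
      F fun k => (w k, I k, J k) := by
  rw [← (Equiv.arrowProdEquivProdArrow (Fin m) (fun _ => Fin j) (fun _ => Fin n × Fin n)).symm.sum_comp,
    Fintype.sum_prod_type]
  refine Finset.sum_congr rfl fun w _ => ?_
  rw [← (Equiv.arrowProdEquivProdArrow (Fin m) (fun _ => Fin n) (fun _ => Fin n)).symm.sum_comp,
    Fintype.sum_prod_type]
  rfl

lemma phi_prod {j n m : ℕ} (g h : Matrix (Fin n) (Fin n) ℂ) (w : Fin m → Fin j)
    (I J : Fin m → Fin n) :
    phi j n g h (∏ k, MvPolynomial.X (w k, I k, J k)) = ∑ A : Fin m → Fin n, ∑ B : Fin m → Fin n,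
      MvPolynomial.C (∏ k, g (I k) (A k) * h (B k) (J k)) *
        ∏ k, MvPolynomial.X (w k, A k, B k) := by
  rw [map_prod]
  simp only [phi, MvPolynomial.aeval_X]
  rw [Finset.prod_univ_sum, Fintype.piFinset_univ]
  refine Finset.sum_congr rfl fun A _ => ?_
  rw [Finset.prod_univ_sum, Fintype.piFinset_univ]
  refine Finset.sum_congr rfl fun B _ => ?_
  rw [Finset.prod_mul_distrib, map_prod]

lemma coeff_invariant {j n m : ℕ} (g h : Matrix (Fin n) (Fin n) ℂ)
    (c : (Fin m → Fin j × Fin n × Fin n) → ℂ)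
    (hc : ∀ (σ : Equiv.Perm (Fin m)) u, c (fun k => u (σ k)) = c u)
    (hφ : phi j n g h (∑ u, MvPolynomial.C (c u) * ∏ k, MvPolynomial.X (u k)) =
      ∑ u, MvPolynomial.C (c u) * ∏ k, MvPolynomial.X (u k))
    (w : Fin m → Fin j) (A B : Fin m → Fin n) :
    ∑ I : Fin m → Fin n, ∑ J : Fin m → Fin n, (∏ k, g (I k) (A k)) *
      c (fun k => (w k, I k, J k)) * (∏ k, h (B k) (J k)) = c (fun k => (w k, A k, B k)) := by
  let c' : (Fin m → Fin j × Fin n × Fin n) → ℂ := fun u =>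
    ∑ I : Fin m → Fin n, ∑ J : Fin m → Fin n, (∏ k, g (I k) (u k).2.1) *
      c (fun k => ((u k).1, I k, J k)) * (∏ k, h (u k).2.2 (J k))
  have hc' : ∀ (σ : Equiv.Perm (Fin m)) u, c' (fun k => u (σ k)) = c' u := by
    intro σ u
    simp only [c']
    rw [← (Equiv.arrowCongr σ.symm (Equiv.refl (Fin n))).sum_comp]
    refine Finset.sum_congr rfl fun I _ => ?_
    rw [← (Equiv.arrowCongr σ.symm (Equiv.refl (Fin n))).sum_comp]
    refine Finset.sum_congr rfl fun J _ => ?_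
    have e : ∀ I : Fin m → Fin n, (Equiv.arrowCongr σ.symm (Equiv.refl (Fin n))) I =
      fun k => I (σ k) := fun I => rfl
    rw [e, e]
    rw [Equiv.prod_comp σ (fun k => g (I k) (u k).2.1),
      Equiv.prod_comp σ (fun k => h (u k).2.2 (J k)),
      hc σ (fun k => ((u k).1, I k, J k))]
  refine symm_unique c' c hc' hc ?_ (fun k => (w k, A k, B k))
  rw [← hφ, map_sum, sum_triple, sum_triple]
  refine Finset.sum_congr rfl fun w _ => ?_
  simp only [map_mul, phi_prod, ← MvPolynomial.algebraMap_eq, AlgHom.commutes]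
  simp only [MvPolynomial.algebraMap_eq, c', map_sum, Finset.mul_sum, Finset.sum_mul]
  -- reorder the four sums
  have reorder : ∀ F : (Fin m → Fin n) → (Fin m → Fin n) → (Fin m → Fin n) → (Fin m → Fin n) →
      MvPolynomial (Fin j × Fin n × Fin n) ℂ,
      ∑ A, ∑ B, ∑ I, ∑ J, F A B I J = ∑ I, ∑ J, ∑ A, ∑ B, F A B I J := by
    intro F
    have h1 : ∀ A, ∑ B, ∑ I, ∑ J, F A B I J = ∑ I, ∑ J, ∑ B, F A B I J := fun A =>
      Finset.sum_comm.trans (Finset.sum_congr rfl fun I _ => Finset.sum_comm)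
    simp only [h1]
    exact Finset.sum_comm.trans (Finset.sum_congr rfl fun I _ => Finset.sum_comm)
  rw [reorder]
  refine Finset.sum_congr rfl fun I _ => Finset.sum_congr rfl fun J _ =>
    Finset.sum_congr rfl fun A _ => Finset.sum_congr rfl fun B _ => ?_
  rw [Finset.prod_mul_distrib]
  simp only [map_mul]
  ring

lemma commutes {n m : ℕ} (g : GL (Fin n) ℂ)
    (c : (Fin m → Fin n) → (Fin m → Fin n) → ℂ)
    (hc : ∀ A B : Fin m → Fin n, ∑ I : Fin m → Fin n, ∑ J : Fin m → Fin n,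
      (∏ k, (g : Matrix (Fin n) (Fin n) ℂ) (I k) (A k)) *
      c I J * (∏ k, ((g⁻¹ : GL (Fin n) ℂ) : Matrix (Fin n) (Fin n) ℂ) (B k) (J k)) = c A B)
    (A B : Fin m → Fin n) :
    ∑ I, (∏ k, (g : Matrix (Fin n) (Fin n) ℂ) (I k) (A k)) * c I B =
        ∑ I, c A I * ∏ k, (g : Matrix (Fin n) (Fin n) ℂ) (B k) (I k) := by
  classical
  set gm := (g : Matrix (Fin n) (Fin n) ℂ)
  set hm := ((g⁻¹ : GL (Fin n) ℂ) : Matrix (Fin n) (Fin n) ℂ)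
  have hgh : gm * hm = 1 := by
    simp only [gm, hm, ← Units.val_mul, mul_inv_cancel, Units.val_one]
  let K : Matrix (Fin n) (Fin n) ℂ → Matrix (Fin m → Fin n) (Fin m → Fin n) ℂ := fun M =>
    Matrix.of fun A B => ∏ k, M (A k) (B k)
  have hK : K gm * K hm = 1 := by
    ext A B
    simp only [Matrix.mul_apply, K, Matrix.of_apply, ← Finset.prod_mul_distrib]
    have := (Finset.prod_univ_sum (fun _ : Fin m => (Finset.univ : Finset (Fin n)))
      (fun k x => gm (A k) x * hm x (B k))).symm
    rw [Fintype.piFinset_univ] at this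
    rw [this]
    simp only [← Matrix.mul_apply, hgh, Matrix.one_apply]
    by_cases h : A = B
    · simp [h]
    · obtain ⟨k, hk⟩ := Function.ne_iff.mp h
      rw [if_neg h]
      exact Finset.prod_eq_zero (Finset.mem_univ k) (if_neg hk)
  have h1 : (K gm)ᵀ * Matrix.of c * (K hm)ᵀ = Matrix.of c := by
    ext A B
    simp only [Matrix.mul_apply, Matrix.transpose_apply, Matrix.of_apply, K, Finset.sum_mul]
    rw [Finset.sum_comm]
    exact hc A B
  have h2 : (K gm)ᵀ * Matrix.of c = Matrix.of c * (K gm)ᵀ := by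
    conv_rhs => rw [← h1, Matrix.mul_assoc _ ((K hm)ᵀ), ← Matrix.transpose_mul, hK,
      Matrix.transpose_one, Matrix.mul_one]
  have := congrFun (congrFun h2 A) B
  simpa only [Matrix.mul_apply, Matrix.transpose_apply, Matrix.of_apply, K] using this

end FFT

/-- First fundamental theorem for `GL(n,ℂ)` (Procesi): a polynomial `P` in the
entries of `j` generic `n × n` complex matrices that is invariant under
simultaneous conjugation by all `g ∈ GL(n,ℂ)` lies in the ℂ-subalgebra
generated by the word-trace polynomials, i.e. the polynomials whose evaluation
at every tuple `x` equals `Tr(x_{i₁} ⋯ x_{i_s})` for some nonempty word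
`i₁, …, i_s` of indices in `Fin j`. -/
theorem fft_GL_invariants (j n : ℕ) (hj : 1 ≤ j) (hn : 1 ≤ n)
    (P : MvPolynomial (Fin j × Fin n × Fin n) ℂ)
    (hinv : ∀ (g : GL (Fin n) ℂ) (x : Fin j → Matrix (Fin n) (Fin n) ℂ),
      MvPolynomial.eval
        (fun p => ((g : Matrix (Fin n) (Fin n) ℂ) * x p.1 *
          ((g⁻¹ : GL (Fin n) ℂ) : Matrix (Fin n) (Fin n) ℂ)) p.2.1 p.2.2) P =
      MvPolynomial.eval (fun p => x p.1 p.2.1 p.2.2) P) :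
    P ∈ Algebra.adjoin ℂ
      {Q : MvPolynomial (Fin j × Fin n × Fin n) ℂ |
        ∃ w : List (Fin j), w ≠ [] ∧
          Q = Matrix.trace
            (w.map fun i =>
              (Matrix.of fun a b => MvPolynomial.X (i, a, b) :
                Matrix (Fin n) (Fin n) (MvPolynomial (Fin j × Fin n × Fin n) ℂ))).prod} := by
  classical
  set A := Algebra.adjoin ℂ
      {Q : MvPolynomial (Fin j × Fin n × Fin n) ℂ |
        ∃ w : List (Fin j), w ≠ [] ∧
          Q = Matrix.trace
            (w.map fun i =>
              (Matrix.of fun a b => MvPolynomial.X (i, a, b) :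
                Matrix (Fin n) (Fin n) (MvPolynomial (Fin j × Fin n × Fin n) ℂ))).prod} with hA
  have hφ : ∀ g : GL (Fin n) ℂ, FFT.phi j n (g : Matrix (Fin n) (Fin n) ℂ)
      ((g⁻¹ : GL (Fin n) ℂ) : Matrix (Fin n) (Fin n) ℂ) P = P := by
    intro g
    apply MvPolynomial.funext
    intro x
    rw [FFT.eval_phi]
    exact hinv g (fun i => Matrix.of fun a b => x (i, a, b))
  rw [← MvPolynomial.sum_homogeneousComponent P]
  refine A.sum_mem fun m _ => ?_
  obtain ⟨c, hc, hQ⟩ := FFT.exists_symm _ (MvPolynomial.homogeneousComponent_isHomogeneous m P)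
  have hφm := fun g : GL (Fin n) ℂ => FFT.phi_component _ _ P (hφ g) m
  rw [hQ] at hφm ⊢
  rw [FFT.sum_triple]
  refine A.sum_mem fun w _ => ?_
  have hspan := FFT.schur_weyl (Matrix.of fun I J => c (fun k => (w k, I k, J k)))
    (fun g => FFT.commutes g (fun I J => c (fun k => (w k, I k, J k)))
      (FFT.coeff_invariant _ _ c hc (hφm g) w))
  have key : ∀ C : Matrix (Fin m → Fin n) (Fin m → Fin n) ℂ,
      C ∈ Submodule.span ℂ (Set.range fun σ : Equiv.Perm (Fin m) =>
        (Matrix.of fun a b => if a = FFT.rho m n σ b then (1 : ℂ) else 0 :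
          Matrix (Fin m → Fin n) (Fin m → Fin n) ℂ)) →
      ∑ I, ∑ J, MvPolynomial.C (C I J) * ∏ k, MvPolynomial.X (w k, I k, J k) ∈ A := by
    intro C hC
    induction hC using Submodule.span_induction with
    | mem x hx =>
      obtain ⟨σ, rfl⟩ := hx
      have := FFT.trace_mem (fun i => (Matrix.of fun a b => MvPolynomial.X (i, a, b) :
                Matrix (Fin n) (Fin n) (MvPolynomial (Fin j × Fin n × Fin n) ℂ))) A
        (fun w hw => Algebra.subset_adjoin ⟨w, hw, rfl⟩) m σ (fun k => [w k]) (by simp)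
      convert this using 1
      refine Finset.sum_congr rfl fun I _ => ?_
      rw [Finset.sum_eq_single (fun k => I (σ k))]
      · have : I = FFT.rho m n σ (fun k => I (σ k)) := by
          ext k; simp [FFT.rho_apply]
        simp [← this]
      · intro J _ hJ
        have : I ≠ FFT.rho m n σ J := by
          rintro rfl
          apply hJ
          ext k; simp [FFT.rho_apply]
        simp [this]
      · simp
    | zero => simp
    | add x y _ _ hx hy =>
      simp only [Matrix.add_apply, map_add, add_mul, Finset.sum_add_distrib]
      exact A.add_mem hx hy
    | smul r x _ hx =>
      have := A.mul_mem (A.algebraMap_mem r) hx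
      simp only [Finset.mul_sum, MvPolynomial.algebraMap_eq, ← mul_assoc, ← map_mul] at this
      simpa only [Matrix.smul_apply, smul_eq_mul] using this
  exact key _ hspan
end

section
/- First fundamental theorem for unitary invariants (Procesi): let j, n ≥ 1 and let F : (Fin j → Matrix (Fin n) (Fin n) ℂ) → ℂ be a function of the form F x = (evaluation of some polynomial P in the entries of 2j generic matrices at the point (x₁,…,x_j, x₁ᴴ,…,x_jᴴ)). If F is invariant under simultaneous unitary conjugation, i.e. F (i ↦ U · (x i) · Uᴴ) = F x for every unitary U ∈ U(n,ℂ) and every tuple x, then F lies in the ℂ-subalgebra of the algebra of all functions (Fin j → Matrix (Fin n) (Fin n) ℂ) → ℂ generated by the word-trace functions x ↦ Tr(w₁ w₂ ⋯ w_s), where each w_t is either x_{i_t} or x_{i_t}ᴴ for some index i_t ∈ Fin j and s ≥ 1. -/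
open Matrix

/-- Double commutant theorem for a finite group of matrices. -/
lemma double_comm {G N : Type*} [Group G] [Fintype G] [Fintype N] [DecidableEq N]
    (P : G →* Matrix N N ℂ) (T : Matrix N N ℂ)
    (hT : ∀ M : Matrix N N ℂ, (∀ g, P g * M = M * P g) → T * M = M * T) :
    T ∈ Submodule.span ℂ (Set.range P) := by
  set A := Submodule.span ℂ (Set.range P) with hA
  obtain ⟨π, hπ⟩ := LinearMap.exists_leftInverse_of_injective A.subtype (Submodule.ker_subtype A)
  have hπ' : ∀ x (hx : x ∈ A), (π x : Matrix N N ℂ) = x := by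
    intro x hx
    have := LinearMap.congr_fun hπ ⟨x, hx⟩
    simpa using congrArg Subtype.val this
  let Q : Matrix N N ℂ →ₗ[ℂ] Matrix N N ℂ :=
    ∑ g : G, (LinearMap.mulLeft ℂ (P g⁻¹)) ∘ₗ A.subtype ∘ₗ π ∘ₗ (LinearMap.mulLeft ℂ (P g))
  have hQ : ∀ X, Q X = ∑ g : G, P g⁻¹ * (π (P g * X) : Matrix N N ℂ) := by
    intro X; simp [Q]
  have hQP : ∀ h X, Q (P h * X) = P h * Q X := by
    intro h X
    rw [hQ, hQ, Finset.mul_sum]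
    refine Fintype.sum_equiv (Equiv.mulRight h) _ _ ?_
    intro g
    simp only [Equiv.coe_mulRight, _root_.mul_inv_rev, map_mul, mul_assoc]
    rw [← mul_assoc (P h) (P h⁻¹), ← map_mul]; simp
  let Mm : N → N → Matrix N N ℂ := fun i j => Matrix.of fun a b => Q (Matrix.single b j 1) a i
  have hsum : ∀ (Y : Matrix N N ℂ) (b j : N), Y * Matrix.single b j (1:ℂ) =
      ∑ c, Y c b • Matrix.single c j (1:ℂ) := by
    intro Y b j
    ext x y
    simp only [Matrix.mul_apply, Matrix.single_apply, Matrix.sum_apply, Matrix.smul_apply]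
    by_cases hy : j = y
    · simp [hy]
    · simp [hy]
  have key : ∀ (Y : Matrix N N ℂ) i j a b,
      (Y * Mm i j) a b = (Y * Q (Matrix.single b j 1)) a i ∧
      (Mm i j * Y) a b = (Q (Y * Matrix.single b j 1)) a i := by
    intro Y i j a b
    constructor
    · simp [Mm, Matrix.mul_apply]
    · rw [hsum, map_sum]
      simp only [map_smul]
      simp only [Mm, Matrix.mul_apply, Matrix.sum_apply, mul_comm, Matrix.smul_apply,
        Matrix.of_apply, smul_eq_mul]
  have hQT : ∀ X, Q (T * X) = T * Q X := by
    intro X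
    induction X using Matrix.induction_on' with
    | h_zero => simp
    | h_add p q hp hq => simp [mul_add, hp, hq]
    | h_std_basis b j x =>
      have hx : Matrix.single b j x = x • Matrix.single b j (1:ℂ) := by simp [Matrix.smul_single]
      rw [hx, Matrix.mul_smul, map_smul, map_smul, Matrix.mul_smul]
      congr 1
      ext a i
      rw [← (key T i j a b).1, ← (key T i j a b).2, hT]
      intro g
      ext a b
      rw [(key _ i j a b).1, (key _ i j a b).2, hQP]
  have h1 : Q 1 = (Fintype.card G : ℂ) • 1 := by
    rw [hQ]
    have : ∀ g : G, P g⁻¹ * (π (P g * 1) : Matrix N N ℂ) = 1 := by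
      intro g
      rw [mul_one, hπ' _ (Submodule.subset_span ⟨g, rfl⟩), ← map_mul]; simp
    rw [Finset.sum_congr rfl fun g _ => this g]
    simp [← Nat.cast_smul_eq_nsmul ℂ, Algebra.smul_def]
  have h2 : Q T = (Fintype.card G : ℂ) • T := by
    have := hQT 1
    rw [h1] at this
    simpa using this
  have hmul : ∀ g, ∀ X ∈ A, P g * X ∈ A := by
    intro g X hX
    induction hX using Submodule.span_induction with
    | mem x hx =>
      obtain ⟨k, rfl⟩ := hx
      rw [← map_mul]; exact Submodule.subset_span ⟨_, rfl⟩
    | zero => simp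
    | add x y _ _ hx hy => rw [mul_add]; exact A.add_mem hx hy
    | smul c x _ hx => rw [Matrix.mul_smul]; exact A.smul_mem _ hx
  have h3 : Q T ∈ A := by
    rw [hQ]
    exact A.sum_mem fun g _ => hmul _ _ (π _).2
  have hc : (Fintype.card G : ℂ) ≠ 0 := by exact_mod_cast Fintype.card_ne_zero
  rw [h2] at h3
  have := A.smul_mem (Fintype.card G : ℂ)⁻¹ h3
  rwa [smul_smul, inv_mul_cancel₀ hc, one_smul] at this

lemma perm_of_sum_single {D : ℕ} {α : Type*} [DecidableEq α] (f g : Fin D → α)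
    (h : ∑ k, Finsupp.single (f k) (1:ℕ) = ∑ k, Finsupp.single (g k) (1:ℕ)) :
    ∃ σ : Equiv.Perm (Fin D), f ∘ σ = g := by
  have hc : ∀ c, Nonempty ({k // g k = c} ≃ {k // f k = c}) := by
    intro c
    rw [← Fintype.card_eq]
    have := DFunLike.congr_fun h c
    simp only [Finsupp.finsetSum_apply, Finsupp.single_apply] at this
    simp only [Fintype.card_subtype, Finset.card_filter]
    exact this.symm
  let e := fun c => (hc c).some
  refine ⟨Equiv.ofFiberEquiv e, ?_⟩
  ext k
  exact Equiv.ofFiberEquiv_map e k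

/-- Unitary matrices are Zariski dense. -/
lemma zariski {n : ℕ} (p : MvPolynomial (Fin n × Fin n) ℂ)
    (hp : ∀ U ∈ Matrix.unitaryGroup (Fin n) ℂ, MvPolynomial.eval (fun q => U q.1 q.2) p = 0) :
    p = 0 := by
  -- the Hermitian case
  have hH : ∀ H : Matrix (Fin n) (Fin n) ℂ, H.IsHermitian →
      MvPolynomial.eval (fun q => H q.1 q.2) p = 0 := by
    intro H hH
    set V : Matrix (Fin n) (Fin n) ℂ := (hH.eigenvectorUnitary : Matrix (Fin n) (Fin n) ℂ) with hV
    have hVu : V ∈ Matrix.unitaryGroup (Fin n) ℂ := hH.eigenvectorUnitary.2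
    let r : MvPolynomial (Fin n) ℂ := MvPolynomial.bind₁ (fun q : Fin n × Fin n =>
      ∑ i, MvPolynomial.C (V q.1 i) * MvPolynomial.X i * MvPolynomial.C (star (V q.2 i))) p
    have hr : ∀ z : Fin n → ℂ, MvPolynomial.eval z r =
        MvPolynomial.eval (fun q => (V * Matrix.diagonal z * star V) q.1 q.2) p := by
      intro z
      simp only [r]
      rw [← MvPolynomial.coe_aeval_eq_eval, ← MvPolynomial.coe_aeval_eq_eval]
      simp only [RingHom.coe_coe]
      rw [MvPolynomial.aeval_bind₁]
      congr 2
      funext q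
      simp [Matrix.mul_apply, Matrix.diagonal_apply, Matrix.star_apply]
    have hr0 : r = 0 := by
      refine MvPolynomial.funext_set (fun _ => Metric.sphere (0:ℂ) 1) (fun _ => ?_) ?_
      · apply Set.infinite_of_injective_forall_mem (f := fun k : ℕ => Complex.exp ((1 / (k+1) : ℝ) * Complex.I))
        · intro a b hab
          have ha : ∀ k : ℕ, (1 / ((k:ℝ)+1)) ∈ Set.Ioc (-Real.pi) Real.pi := by
            intro k
            have : 0 < 1 / ((k:ℝ)+1) := by positivity
            have h1 : 1 / ((k:ℝ)+1) ≤ 1 := by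
              rw [div_le_one (by positivity)]; linarith [(Nat.cast_nonneg k : (0:ℝ) ≤ k)]
            constructor <;> linarith [Real.pi_gt_three]
          have := congrArg Complex.arg hab
          simp only [Complex.arg_exp_mul_I] at this
          rw [(toIocMod_eq_self _).2, (toIocMod_eq_self _).2] at this
          · have h2 := inv_injective (by simpa only [one_div] using this)
            exact_mod_cast (add_left_injective (1:ℝ) h2)
          · have := ha b; constructor <;> linarith [this.1, this.2]
          · have := ha a; constructor <;> linarith [this.1, this.2]
        · intro k
          simp only [mem_sphere_iff_norm, sub_zero]
          exact Complex.norm_exp_ofReal_mul_I _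
      · intro z hz
        rw [hr, hp _ ?_]
        · simp
        · have hd : Matrix.diagonal z ∈ Matrix.unitaryGroup (Fin n) ℂ := by
            rw [Matrix.mem_unitaryGroup_iff, Matrix.star_eq_conjTranspose,
              Matrix.diagonal_conjTranspose, Matrix.diagonal_mul_diagonal, ← Matrix.diagonal_one]
            congr 1; funext i
            have := hz i trivial
            simp only [mem_sphere_iff_norm, sub_zero] at this
            simp [Complex.mul_conj, Complex.normSq_eq_norm_sq, this]
          exact mul_mem (mul_mem hVu hd) (Unitary.star_mem hVu)
    have hs := hH.spectral_theorem
    rw [Unitary.conjStarAlgAut_apply] at hs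
    have := hr (RCLike.ofReal ∘ hH.eigenvalues)
    rw [hr0] at this
    rw [hs]
    simpa using this.symm
  apply MvPolynomial.funext
  intro x
  let A : Matrix (Fin n) (Fin n) ℂ := Matrix.of fun a b => x (a, b)
  let H : Matrix (Fin n) (Fin n) ℂ := (1/2 : ℂ) • (A + Aᴴ)
  let K : Matrix (Fin n) (Fin n) ℂ := (-Complex.I/2 : ℂ) • (A - Aᴴ)
  have hHh : H.IsHermitian := by
    ext a b; simp [H]; ring
  have hKh : K.IsHermitian := by
    ext a b; simp [K]; ring
  let r : Polynomial ℂ := MvPolynomial.aeval (fun q : Fin n × Fin n =>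
      Polynomial.C (H q.1 q.2) + Polynomial.X * Polynomial.C (K q.1 q.2)) p
  have hr : ∀ z, r.eval z = MvPolynomial.eval (fun q => (H + z • K) q.1 q.2) p := by
    intro z
    simp only [r]
    rw [← MvPolynomial.coe_aeval_eq_eval, ← Polynomial.coe_aeval_eq_eval]
    simp only [RingHom.coe_coe]
    rw [← AlgHom.comp_apply, MvPolynomial.comp_aeval]
    congr 2
    funext q
    simp
    ring
  have hr0 : r = 0 := by
    apply Polynomial.eq_zero_of_infinite_isRoot
    apply Set.infinite_of_injective_forall_mem (f := fun k : ℕ => (k:ℂ))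
    · exact Nat.cast_injective
    · intro k
      change r.eval _ = 0
      rw [hr]
      apply hH
      ext a b
      have h1 := congrFun (congrFun hHh a) b
      have h2 := congrFun (congrFun hKh a) b
      simp only [Matrix.conjTranspose_apply] at h1 h2
      simp [h1, h2] 
  have := hr Complex.I
  rw [hr0] at this
  have hx : (fun q : Fin n × Fin n => (H + Complex.I • K) q.1 q.2) = x := by
    funext q
    simp [H, K, A]
    ring_nf
    simp
    ring
  rw [hx] at this
  simpa using this.symm

/-- Tensor powers of matrices. -/
def tp {n : ℕ} (D : ℕ) (U : Matrix (Fin n) (Fin n) ℂ) :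
    Matrix (Fin D → Fin n) (Fin D → Fin n) ℂ :=
  Matrix.of fun a b => ∏ k, U (a k) (b k)

lemma tp_mul {n : ℕ} (D : ℕ) (U V : Matrix (Fin n) (Fin n) ℂ) :
    tp D (U * V) = tp D U * tp D V := by
  ext a b
  simp only [tp, Matrix.mul_apply, Matrix.of_apply, Finset.prod_univ_sum, Fintype.piFinset_univ,
    Finset.prod_mul_distrib]

lemma tp_one {n : ℕ} (D : ℕ) : tp D (1 : Matrix (Fin n) (Fin n) ℂ) = 1 := by
  ext a b
  simp only [tp, Matrix.of_apply, Matrix.one_apply, Finset.prod_ite_zero, funext_iff]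
  simp

/-- The action of permutations on tensor powers. -/
def permHom (n D : ℕ) : Equiv.Perm (Fin D) →* Matrix (Fin D → Fin n) (Fin D → Fin n) ℂ where
  toFun σ := Matrix.of fun a b => if a ∘ σ = b then 1 else 0
  map_one' := by ext a b; simp [Matrix.one_apply]
  map_mul' σ τ := by
    ext a b
    simp only [Matrix.mul_apply, Matrix.of_apply, ite_mul, one_mul, zero_mul,
      Finset.sum_ite_eq, Finset.mem_univ, if_true, Equiv.Perm.coe_mul, Function.comp_assoc]
    congr

lemma schur_weyl {n D : ℕ} (T : Matrix (Fin D → Fin n) (Fin D → Fin n) ℂ)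
    (hT : ∀ U ∈ Matrix.unitaryGroup (Fin n) ℂ, T * tp D U = tp D U * T) :
    T ∈ Submodule.span ℂ (Set.range (permHom n D)) := by
  apply double_comm
  intro M hM
  have hM' : ∀ (σ : Equiv.Perm (Fin D)) a b, M (a ∘ σ) (b ∘ σ) = M a b := by
    intro σ a b
    have := congrFun (congrFun (hM σ) a) (b ∘ σ)
    simp only [permHom, MonoidHom.coe_mk, OneHom.coe_mk, Matrix.mul_apply, Matrix.of_apply,
      ite_mul, one_mul, zero_mul, mul_ite, mul_one, mul_zero] at this
    rw [Finset.sum_ite_eq] at this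
    simp only [Finset.mem_univ, if_true] at this
    rw [this, Finset.sum_eq_single b]
    · simp
    · intro c _ hc
      rw [if_neg]
      intro h
      apply hc
      exact σ.surjective.injective_comp_right h
    · simp
  classical
  let e : (Fin D → Fin n) → (Fin D → Fin n) → (Fin n × Fin n →₀ ℕ) :=
    fun a b => ∑ k, Finsupp.single (a k, b k) 1
  let f : (Fin n × Fin n →₀ ℕ) → ℂ := fun m =>
    if h : ∃ ab : (Fin D → Fin n) × (Fin D → Fin n), e ab.1 ab.2 = m
      then M h.choose.1 h.choose.2 else 0
  have hf : ∀ a b, f (e a b) = M a b := by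
    intro a b
    have h : ∃ ab : (Fin D → Fin n) × (Fin D → Fin n), e ab.1 ab.2 = e a b := ⟨(a, b), rfl⟩
    simp only [f, dif_pos h]
    have hs := h.choose_spec
    obtain ⟨σ, hσ⟩ := perm_of_sum_single (fun k => (h.choose.1 k, h.choose.2 k))
      (fun k => (a k, b k)) hs
    rw [← hM' σ]
    congr 1
    · funext k; exact congrArg Prod.fst (congrFun hσ k)
    · funext k; exact congrArg Prod.snd (congrFun hσ k)
  let lam : MvPolynomial (Fin n × Fin n) ℂ →ₗ[ℂ] ℂ :=
    (MvPolynomial.basisMonomials (Fin n × Fin n) ℂ).constr ℂ f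
  have hmon : ∀ a b : Fin D → Fin n, (∏ k, MvPolynomial.X (a k, b k) :
      MvPolynomial (Fin n × Fin n) ℂ) = MvPolynomial.monomial (e a b) 1 := by
    intro a b
    simp only [e, MvPolynomial.X]
    rw [MvPolynomial.monomial_sum_one]
  have hlam : ∀ a b : Fin D → Fin n, lam (∏ k, MvPolynomial.X (a k, b k)) = M a b := by
    intro a b
    rw [hmon, ← hf]
    exact Module.Basis.constr_basis (MvPolynomial.basisMonomials (Fin n × Fin n) ℂ) ℂ f (e a b)
  ext a b
  have hz := zariski (∑ c, T a c • (∏ k, MvPolynomial.X (c k, b k) :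
      MvPolynomial (Fin n × Fin n) ℂ) - ∑ c, T c b • (∏ k, MvPolynomial.X (a k, c k) :
      MvPolynomial (Fin n × Fin n) ℂ)) (by
    intro U hU
    have := congrFun (congrFun (hT U hU) a) b
    simp only [Matrix.mul_apply, tp, Matrix.of_apply] at this
    simp only [map_sub, map_sum, MvPolynomial.smul_eval, map_prod, MvPolynomial.eval_X]
    rw [this, sub_eq_zero]
    exact Finset.sum_congr rfl fun c _ => mul_comm _ _)
  have := congrArg lam hz
  simp only [map_sub, map_sum, map_smul, hlam, map_zero, smul_eq_mul] at this
  rw [sub_eq_zero] at this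
  rw [Matrix.mul_apply, Matrix.mul_apply, this]
  exact Finset.sum_congr rfl fun c _ => mul_comm _ _

lemma orth_decomp {ι : Type*} [Fintype ι] (N : Submodule ℂ (ι → ℂ)) (c : ι → ℂ) :
    ∃ c2 : ι → ℂ, c - c2 ∈ N ∧ ∀ k ∈ N, ∑ i, c2 i * star (k i) = 0 := by
  let e := (WithLp.linearEquiv 2 ℂ (ι → ℂ))
  let N' : Submodule ℂ (EuclideanSpace ℂ ι) := N.comap e.toLinearMap
  obtain ⟨y, hy, z, hz, hyz⟩ := N'.exists_add_mem_mem_orthogonal (e.symm c)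
  refine ⟨e z, ?_, ?_⟩
  · have : c - e z = e y := by
      have := congrArg e hyz
      simp at this
      rw [this]; simp
    rw [this]; exact hy
  · intro k hk
    have := hz (e.symm k) (by simpa [N'] using hk)
    simpa [PiLp.inner_apply, e] using this

section words
variable {j n : ℕ}

/-- Evaluation of a word. -/
def ev (x : Fin j → Matrix (Fin n) (Fin n) ℂ) (w : List (Fin j × Bool)) :
    Matrix (Fin n) (Fin n) ℂ :=
  (w.map fun t => if t.2 then (x t.1)ᴴ else x t.1).prod

/-- The algebra of trace functions. -/
def TA (j n : ℕ) : Subalgebra ℂ ((Fin j → Matrix (Fin n) (Fin n) ℂ) → ℂ) :=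
  Algebra.adjoin ℂ
      {G : (Fin j → Matrix (Fin n) (Fin n) ℂ) → ℂ |
        ∃ w : List (Fin j × Bool), w ≠ [] ∧
          G = fun x => Matrix.trace
            (w.map fun t => if t.2 then (x t.1)ᴴ else x t.1).prod}

lemma trace_mem (w : List (Fin j × Bool)) : (fun x => (ev x w).trace) ∈ TA j n := by
  by_cases h : w = []
  · subst h
    have : (fun x : Fin j → Matrix (Fin n) (Fin n) ℂ => (ev x []).trace) =
        algebraMap ℂ _ (n : ℂ) := by
      funext x; simp [ev]
    rw [this]; exact Subalgebra.algebraMap_mem _ _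
  · exact Algebra.subset_adjoin ⟨w, h, rfl⟩

lemma perm_trace_mem (ι : Type) [Fintype ι] :
    ∀ [DecidableEq ι] (σ : Equiv.Perm ι) (w : ι → List (Fin j × Bool)),
    (fun x => ∑ a : ι → Fin n, ∏ k, ev x (w k) (a k) (a (σ k))) ∈ TA j n := by
  refine Fintype.induction_empty_option (P := fun ι _ => ∀ [DecidableEq ι] (σ : Equiv.Perm ι)
    (w : ι → List (Fin j × Bool)),
    (fun x => ∑ a : ι → Fin n, ∏ k, ev x (w k) (a k) (a (σ k))) ∈ TA j n) ?_ ?_ ?_ ι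
  · intro α β _ e ih _ σ w
    classical
    let _ : Fintype α := Fintype.ofEquiv β e.symm
    have := ih ((e.trans σ).trans e.symm) (w ∘ e)
    convert this using 2 with x
    refine Fintype.sum_equiv (e.arrowCongr (Equiv.refl _)).symm _ _ ?_
    intro a
    refine Fintype.prod_equiv e.symm _ _ ?_
    intro k
    simp
  · intro _ σ w
    have : (fun x : Fin j → Matrix (Fin n) (Fin n) ℂ =>
      ∑ a : PEmpty → Fin n, ∏ k, ev x (w k) (a k) (a (σ k))) = 1 := by
      funext x; simp
    rw [this]; exact one_mem _
  · intro α _ ih _ σ w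
    classical
    have hsplit : ∀ x : Fin j → Matrix (Fin n) (Fin n) ℂ,
        ∑ a : Option α → Fin n, ∏ k, ev x (w k) (a k) (a (σ k)) =
        ∑ a : α → Fin n, ∑ i : Fin n, ev x (w none) i ((fun o => Option.elim o i a) (σ none)) *
          ∏ k : α, ev x (w (some k)) (a k) ((fun o => Option.elim o i a) (σ (some k))) := by
      intro x
      rw [← Fintype.sum_prod_type']
      refine Fintype.sum_equiv
        ⟨fun a => (fun k => a (some k), a none), fun p => fun o => Option.elim o p.2 p.1, ?_, ?_⟩
        _ _ ?_
      · intro a; funext o; cases o <;> rfl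
      · intro p; rfl
      · intro a
        have ha : ∀ o : Option α, Option.elim o (a none) (fun k => a (some k)) = a o := by
          intro o; cases o <;> rfl
        change _ = ev x (w none) (a none) (Option.elim (σ none) (a none) fun k => a (some k)) *
          ∏ k : α, ev x (w (some k)) (a (some k))
            (Option.elim (σ (some k)) (a none) fun k => a (some k))
        simp only [Fintype.prod_option, ha]
    by_cases h0 : σ none = none
    · have hs : ∀ k, σ (some k) = some (Equiv.removeNone σ k) := by
        intro k
        rw [Equiv.removeNone_some]
        cases h : σ (some k) with
        | none => exact absurd (σ.injective (h.trans h0.symm)) (by simp)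
        | some y => exact ⟨y, rfl⟩
      have := mul_mem (trace_mem (n := n) (w none)) (ih (Equiv.removeNone σ) (fun k => w (some k)))
      convert this using 1
      funext x
      rw [hsplit]
      simp only [h0, hs, Option.elim, Pi.mul_apply, ← Finset.sum_mul]
      rw [Finset.mul_sum]
      rfl
    · obtain ⟨l, hl⟩ := Option.ne_none_iff_exists'.1 h0
      obtain ⟨k0, hk0⟩ : ∃ k0, σ (some k0) = none := by
        cases h : σ.symm none with
        | none => exact absurd ((Equiv.symm_apply_eq _).1 h).symm h0
        | some k => exact ⟨k, ((Equiv.symm_apply_eq _).1 h).symm⟩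
      have hr0 : Equiv.removeNone σ k0 = l := by
        have := Equiv.removeNone_none σ hk0
        rw [hl] at this; simpa using this
      have hs : ∀ k, k ≠ k0 → σ (some k) = some (Equiv.removeNone σ k) := by
        intro k hk
        rw [Equiv.removeNone_some]
        cases h : σ (some k) with
        | none => exact absurd (σ.injective (h.trans hk0.symm)) (by simpa using hk)
        | some y => exact ⟨y, rfl⟩
      have := ih (Equiv.removeNone σ)
        (Function.update (fun k => w (some k)) k0 (w (some k0) ++ w none))
      convert this using 1
      funext x
      rw [hsplit]
      refine Finset.sum_congr rfl fun a _ => ?_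
      rw [← Finset.mul_prod_erase _ _ (Finset.mem_univ k0)]
      simp only [Function.update_self, hr0]
      have happ : ev x (w (some k0) ++ w none) = ev x (w (some k0)) * ev x (w none) := by
        simp [ev]
      rw [happ, Matrix.mul_apply, Finset.sum_mul]
      refine Finset.sum_congr rfl fun i _ => ?_
      rw [← Finset.mul_prod_erase _ _ (Finset.mem_univ k0)]
      simp only [hl, hk0, Option.elim]
      rw [← mul_assoc, mul_comm (ev x (w none) _ _)]
      congr 1
      refine Finset.prod_congr rfl fun k hk => ?_
      have hk' := Finset.ne_of_mem_erase hk
      rw [hs k hk', Function.update_of_ne hk']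
end words

section assembly
variable {j n : ℕ}

/-- Index set for the coefficients. -/
abbrev Ix (j n D : ℕ) : Type :=
  (Fin D → Option (Fin j × Bool)) × (Fin D → Fin n) × (Fin D → Fin n)

/-- The value of an optional letter. -/
def yv (x : Fin j → Matrix (Fin n) (Fin n) ℂ) (o : Option (Fin j × Bool)) :
    Matrix (Fin n) (Fin n) ℂ := ev x o.toList

/-- Coefficients to functions. -/
def Phi (j n D : ℕ) : (Ix j n D → ℂ) →ₗ[ℂ] ((Fin j → Matrix (Fin n) (Fin n) ℂ) → ℂ) where
  toFun c := fun x => ∑ i, c i * ∏ k, yv x (i.1 k) (i.2.1 k) (i.2.2 k)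
  map_add' c d := by funext x; simp [add_mul, Finset.sum_add_distrib]
  map_smul' r c := by funext x; simp [Finset.mul_sum, mul_assoc]

/-- The action of matrices on coefficients. -/
def rho {D : ℕ} (U : Matrix (Fin n) (Fin n) ℂ) (c : Ix j n D → ℂ) : Ix j n D → ℂ :=
  fun i => ∑ a, ∑ b, c (i.1, a, b) * (tp D U a i.2.1 * star (tp D U b i.2.2))

lemma yv_conj (x : Fin j → Matrix (Fin n) (Fin n) ℂ) (o : Option (Fin j × Bool))
    (U : Matrix (Fin n) (Fin n) ℂ) (hU : U ∈ Matrix.unitaryGroup (Fin n) ℂ) :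
    yv (fun i => U * x i * Uᴴ) o = U * yv x o * Uᴴ := by
  cases o with
  | none =>
    have := Matrix.mem_unitaryGroup_iff.1 hU
    rw [Matrix.star_eq_conjTranspose] at this
    simp [yv, ev, this]
  | some t =>
    simp only [yv, ev, Option.toList_some, List.map_cons, List.map_nil, List.prod_singleton]
    split_ifs
    · simp [Matrix.conjTranspose_mul, Matrix.mul_assoc]
    · rfl

lemma Phi_conj {D : ℕ} (c : Ix j n D → ℂ) (x : Fin j → Matrix (Fin n) (Fin n) ℂ)
    (U : Matrix (Fin n) (Fin n) ℂ) (hU : U ∈ Matrix.unitaryGroup (Fin n) ℂ) :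
    Phi j n D c (fun i => U * x i * Uᴴ) = Phi j n D (rho U c) x := by
  simp only [Phi, LinearMap.coe_mk, AddHom.coe_mk, yv_conj _ _ _ hU]
  rw [Fintype.sum_prod_type, Fintype.sum_prod_type]
  refine Finset.sum_congr rfl fun w _ => ?_
  rw [Fintype.sum_prod_type, Fintype.sum_prod_type]
  have hexp : ∀ a b : Fin D → Fin n, ∏ k, (U * yv x (w k) * Uᴴ) (a k) (b k) =
      ∑ p : Fin D → Fin n, ∑ q : Fin D → Fin n,
        (tp D U a p * star (tp D U b q)) * ∏ k, yv x (w k) (p k) (q k) := by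
    intro a b
    have h1 : ∀ k, (U * yv x (w k) * Uᴴ) (a k) (b k) =
        ∑ q, ∑ p, U (a k) p * yv x (w k) p q * star (U (b k) q) := by
      intro k
      simp only [Matrix.mul_apply, Matrix.conjTranspose_apply, Finset.sum_mul]
    simp only [h1, Finset.prod_univ_sum, Fintype.piFinset_univ]
    rw [Finset.sum_comm]
    refine Finset.sum_congr rfl fun p _ => Finset.sum_congr rfl fun q _ => ?_
    simp only [tp, Matrix.of_apply, Finset.prod_mul_distrib, star_prod]
    ring
  simp only [hexp, rho, Finset.mul_sum, Finset.sum_mul]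
  calc _ = ∑ a : Fin D → Fin n, ∑ p : Fin D → Fin n, ∑ b : Fin D → Fin n, ∑ q : Fin D → Fin n,
        c (w, a, b) * ((tp D U a p * star (tp D U b q)) * ∏ k, yv x (w k) (p k) (q k)) :=
        Finset.sum_congr rfl fun a _ => Finset.sum_comm
    _ = ∑ p : Fin D → Fin n, ∑ a : Fin D → Fin n, ∑ q : Fin D → Fin n, ∑ b : Fin D → Fin n,
        c (w, a, b) * ((tp D U a p * star (tp D U b q)) * ∏ k, yv x (w k) (p k) (q k)) := by
        rw [Finset.sum_comm]
        exact Finset.sum_congr rfl fun p _ => Finset.sum_congr rfl fun a _ => Finset.sum_comm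
    _ = _ := by
        refine Finset.sum_congr rfl fun p _ => ?_
        rw [Finset.sum_comm]
        refine Finset.sum_congr rfl fun q _ => Finset.sum_congr rfl fun a _ =>
          Finset.sum_congr rfl fun b _ => ?_
        ring

lemma rho_adj {D : ℕ} (c k : Ix j n D → ℂ) (U : Matrix (Fin n) (Fin n) ℂ) :
    ∑ i, rho U c i * star (k i) = ∑ i, c i * star (rho Uᴴ k i) := by
  rw [Fintype.sum_prod_type, Fintype.sum_prod_type]
  refine Finset.sum_congr rfl fun w _ => ?_
  have htp : ∀ a b, tp D Uᴴ a b = star (tp D U b a) := by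
    intro a b; simp [tp]
  simp only [rho, Finset.sum_mul, star_sum, Finset.mul_sum, htp, star_mul', star_star]
  simp only [← Fintype.sum_prod_type']
  refine Fintype.sum_equiv (Equiv.prodComm _ _) _ _ ?_
  intro p
  simp only [Equiv.prodComm_apply, Prod.fst_swap, Prod.snd_swap]
  ring

lemma monomial_mem {D : ℕ} (hn : 1 ≤ n) (l : List (Option (Fin j × Bool) × Fin n × Fin n))
    (hl : l.length ≤ D) :
    (fun x => (l.map fun t => yv x t.1 t.2.1 t.2.2).prod) ∈ LinearMap.range (Phi j n D) := by
  classical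
  let z : Fin n := ⟨0, hn⟩
  let d : Option (Fin j × Bool) × Fin n × Fin n := (none, z, z)
  let g : Fin D → Option (Fin j × Bool) × Fin n × Fin n := fun k => l.getD k d
  refine ⟨Pi.single (fun k => (g k).1, fun k => (g k).2.1, fun k => (g k).2.2) 1, ?_⟩
  funext x
  simp only [Phi, LinearMap.coe_mk, AddHom.coe_mk, Pi.single_apply, ite_mul, one_mul, zero_mul,
    Finset.sum_ite_eq', Finset.mem_univ, if_true]
  have hd : yv x d.1 d.2.1 d.2.2 = 1 := by simp [yv, ev, d]
  have : ∀ (D : ℕ) (l : List (Option (Fin j × Bool) × Fin n × Fin n)), l.length ≤ D →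
      ∏ k : Fin D, yv x (l.getD k d).1 (l.getD k d).2.1 (l.getD k d).2.2 =
        (l.map fun t => yv x t.1 t.2.1 t.2.2).prod := by
    intro D
    induction D with
    | zero => intro l hl; simp at hl; simp [hl]
    | succ D ih =>
      intro l hl
      cases l with
      | nil => simp [hd]
      | cons t l =>
        rw [Fin.prod_univ_succ]
        simp only [Fin.val_zero, List.getD_cons_zero, Fin.val_succ, List.getD_cons_succ,
          List.map_cons, List.prod_cons]
        rw [ih l (by simpa using hl)]
  exact this D l hl


lemma poly_mem (hn : 1 ≤ n) (P : MvPolynomial ((Fin j ⊕ Fin j) × Fin n × Fin n) ℂ) :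
    (fun x : Fin j → Matrix (Fin n) (Fin n) ℂ => MvPolynomial.eval
          (fun p => Sum.elim x (fun i => (x i)ᴴ) p.1 p.2.1 p.2.2) P) ∈
      LinearMap.range (Phi j n P.totalDegree) := by
  have h : (fun x : Fin j → Matrix (Fin n) (Fin n) ℂ => MvPolynomial.eval
          (fun p => Sum.elim x (fun i => (x i)ᴴ) p.1 p.2.1 p.2.2) P) =
      ∑ m ∈ P.support, P.coeff m • (fun x : Fin j → Matrix (Fin n) (Fin n) ℂ =>
        m.prod fun p e => (Sum.elim x (fun i => (x i)ᴴ) p.1 p.2.1 p.2.2) ^ e) := by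
    funext x
    rw [MvPolynomial.eval_eq]
    simp [Finset.sum_apply, Finsupp.prod]
  rw [h]
  refine Submodule.sum_mem _ fun m hm => Submodule.smul_mem _ _ ?_
  let enc : (Fin j ⊕ Fin j) × Fin n × Fin n → Option (Fin j × Bool) × Fin n × Fin n :=
    fun p => (some (Sum.elim (fun i => (i, false)) (fun i => (i, true)) p.1), p.2)
  have henc : ∀ (x : Fin j → Matrix (Fin n) (Fin n) ℂ) p,
      yv x (enc p).1 (enc p).2.1 (enc p).2.2 =
        Sum.elim x (fun i => (x i)ᴴ) p.1 p.2.1 p.2.2 := by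
    rintro x ⟨i | i, a, b⟩ <;> simp [enc, yv, ev]
  have hlen : (m.toMultiset.toList.map enc).length ≤ P.totalDegree := by
    rw [List.length_map, Multiset.length_toList, Finsupp.card_toMultiset]
    exact MvPolynomial.le_totalDegree hm
  have := monomial_mem hn (m.toMultiset.toList.map enc) hlen
  convert this using 1
  funext x
  rw [List.map_map]
  have hc : ((fun t : Option (Fin j × Bool) × Fin n × Fin n => yv x t.1 t.2.1 t.2.2) ∘ enc) =
      fun p => Sum.elim x (fun i => (x i)ᴴ) p.1 p.2.1 p.2.2 := by
    funext p; exact henc x p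
  rw [hc, ← Multiset.prod_coe, ← Multiset.map_coe, Multiset.coe_toList, Finsupp.toMultiset_map,
    Finsupp.prod_toMultiset, Finsupp.prod_mapDomain_index]
  · simp
  · intro b a a'; rw [pow_add]

lemma range_inv_mem {D : ℕ} (F : (Fin j → Matrix (Fin n) (Fin n) ℂ) → ℂ)
    (hF : F ∈ LinearMap.range (Phi j n D))
    (hinv : ∀ U ∈ Matrix.unitaryGroup (Fin n) ℂ,
      ∀ x : Fin j → Matrix (Fin n) (Fin n) ℂ, F (fun i => U * x i * Uᴴ) = F x) :
    F ∈ TA j n := by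
  obtain ⟨c, rfl⟩ := hF
  obtain ⟨c2, hc2, horth⟩ := orth_decomp (LinearMap.ker (Phi j n D)) c
  have hcc : Phi j n D c = Phi j n D c2 := by
    rw [LinearMap.mem_ker, map_sub, sub_eq_zero] at hc2; exact hc2
  rw [hcc] at hinv ⊢
  have hstar : ∀ U ∈ Matrix.unitaryGroup (Fin n) ℂ, Uᴴ ∈ Matrix.unitaryGroup (Fin n) ℂ := by
    intro U hU
    rw [← Matrix.star_eq_conjTranspose]; exact Unitary.star_mem hU
  have hker : ∀ U ∈ Matrix.unitaryGroup (Fin n) ℂ, ∀ k ∈ LinearMap.ker (Phi j n D),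
      rho U k ∈ LinearMap.ker (Phi j n D) := by
    intro U hU k hk
    rw [LinearMap.mem_ker] at hk ⊢
    funext x
    rw [← Phi_conj k x U hU, hk]; rfl
  have hrho : ∀ U ∈ Matrix.unitaryGroup (Fin n) ℂ, rho U c2 = c2 := by
    intro U hU
    have hd : rho U c2 - c2 ∈ LinearMap.ker (Phi j n D) := by
      rw [LinearMap.mem_ker, map_sub, sub_eq_zero]
      funext x
      rw [← Phi_conj c2 x U hU, hinv U hU]
    have h1 := horth _ hd
    have h2 := horth _ (hker _ (hstar U hU) _ hd)
    rw [← rho_adj] at h2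
    have h3 : ∑ i, (rho U c2 - c2) i * star ((rho U c2 - c2) i) = 0 := by
      have : ∑ i, (rho U c2 - c2) i * star ((rho U c2 - c2) i) =
          ∑ i, rho U c2 i * star ((rho U c2 - c2) i) - ∑ i, c2 i * star ((rho U c2 - c2) i) := by
        rw [← Finset.sum_sub_distrib]
        refine Finset.sum_congr rfl fun i _ => ?_
        rw [← sub_mul]; rfl
      rw [this, h1, h2, sub_zero]
    have h4 : rho U c2 - c2 = 0 := by
      have : (rho U c2 - c2) ⬝ᵥ star (rho U c2 - c2) = 0 := h3
      open ComplexOrder in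
      exact dotProduct_self_star_eq_zero.1 this
    exact sub_eq_zero.1 h4
  let T : (Fin D → Option (Fin j × Bool)) → Matrix (Fin D → Fin n) (Fin D → Fin n) ℂ :=
    fun w => Matrix.of fun a b => c2 (w, a, b)
  have hT : ∀ w, ∀ V ∈ Matrix.unitaryGroup (Fin n) ℂ, T w * tp D V = tp D V * T w := by
    intro w V hV
    have hVt : Vᵀ ∈ Matrix.unitaryGroup (Fin n) ℂ := Matrix.transpose_mem_unitaryGroup_iff.2 hV
    have hfix : tp D V * T w * tp D Vᴴ = T w := by
      ext p q
      have := congrFun (hrho _ hVt) (w, p, q)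
      simp only [T, Matrix.of_apply]
      rw [← this]
      simp only [rho, Matrix.mul_apply, Finset.sum_mul, Matrix.of_apply]
      rw [Finset.sum_comm]
      refine Finset.sum_congr rfl fun a _ => Finset.sum_congr rfl fun b _ => ?_
      simp only [tp, Matrix.of_apply, Matrix.transpose_apply, Matrix.conjTranspose_apply,
        star_prod]
      ring
    have hVV : Vᴴ * V = 1 := by
      have := Matrix.mem_unitaryGroup_iff'.1 hV
      rwa [Matrix.star_eq_conjTranspose] at this
    calc T w * tp D V = tp D V * T w * tp D Vᴴ * tp D V := by rw [hfix]
      _ = tp D V * T w := by rw [Matrix.mul_assoc, ← tp_mul, hVV, tp_one, Matrix.mul_one]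
  have hspan := fun w => (Submodule.mem_span_range_iff_exists_fun ℂ).1 (schur_weyl (T w) (hT w))
  choose d hd using hspan
  have hfinal : Phi j n D c2 = ∑ w : Fin D → Option (Fin j × Bool), ∑ σ : Equiv.Perm (Fin D),
      d w σ • (fun x : Fin j → Matrix (Fin n) (Fin n) ℂ =>
        ∑ a : Fin D → Fin n, ∏ k, ev x ((w k).toList) (a k) (a (σ k))) := by
    funext x
    simp only [Phi, LinearMap.coe_mk, AddHom.coe_mk, Finset.sum_apply, Pi.smul_apply, smul_eq_mul]
    rw [Fintype.sum_prod_type]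
    refine Finset.sum_congr rfl fun w _ => ?_
    rw [Fintype.sum_prod_type]
    have hval : ∀ a b, c2 (w, a, b) = ∑ σ, d w σ * (if a ∘ σ = b then 1 else 0) := by
      intro a b
      have := congrFun (congrFun (hd w) a) b
      simp only [Matrix.sum_apply, Matrix.smul_apply, smul_eq_mul] at this
      exact this.symm
    simp only [hval, Finset.sum_mul, Finset.mul_sum]
    have hsw : ∀ a : Fin D → Fin n, ∑ b : Fin D → Fin n, ∑ σ : Equiv.Perm (Fin D),
        d w σ * (if a ∘ σ = b then 1 else 0) * ∏ k, yv x (w k) (a k) (b k) =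
        ∑ σ : Equiv.Perm (Fin D), d w σ * ∏ k, ev x ((w k).toList) (a k) (a (σ k)) := by
      intro a
      rw [Finset.sum_comm]
      refine Finset.sum_congr rfl fun σ _ => ?_
      rw [Finset.sum_eq_single (a ∘ σ)]
      · simp [yv]
      · intro b _ hb; simp [hb.symm]
      · simp
    rw [Finset.sum_congr rfl fun a _ => hsw a, Finset.sum_comm]
  rw [hfinal]
  exact Subalgebra.sum_mem _ fun w _ => Subalgebra.sum_mem _ fun σ _ =>
    Subalgebra.smul_mem _ (perm_trace_mem (Fin D) σ fun k => (w k).toList) _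

end assembly

/-- First fundamental theorem for unitary invariants (Procesi): if
`F : (Fin j → Matrix (Fin n) (Fin n) ℂ) → ℂ` is given by evaluating a
polynomial in `2j` generic matrices at `(x₁, …, x_j, x₁ᴴ, …, x_jᴴ)` and `F` is
invariant under simultaneous unitary conjugation, then `F` lies in the
ℂ-subalgebra of functions generated by the word-trace functions
`x ↦ Tr(w₁ ⋯ w_s)`, where each `w_t` is `x_{i_t}` or `x_{i_t}ᴴ`. -/
theorem fft_unitary_invariants (j n : ℕ) (hj : 1 ≤ j) (hn : 1 ≤ n)
    (F : (Fin j → Matrix (Fin n) (Fin n) ℂ) → ℂ)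
    (hpoly : ∃ P : MvPolynomial ((Fin j ⊕ Fin j) × Fin n × Fin n) ℂ,
      ∀ x : Fin j → Matrix (Fin n) (Fin n) ℂ,
        F x = MvPolynomial.eval
          (fun p => Sum.elim x (fun i => (x i)ᴴ) p.1 p.2.1 p.2.2) P)
    (hinv : ∀ U ∈ Matrix.unitaryGroup (Fin n) ℂ,
      ∀ x : Fin j → Matrix (Fin n) (Fin n) ℂ,
        F (fun i => U * x i * Uᴴ) = F x) :
    F ∈ Algebra.adjoin ℂ
      {G : (Fin j → Matrix (Fin n) (Fin n) ℂ) → ℂ |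
        ∃ w : List (Fin j × Bool), w ≠ [] ∧
          G = fun x => Matrix.trace
            (w.map fun t => if t.2 then (x t.1)ᴴ else x t.1).prod} := by
  obtain ⟨P, hP⟩ := hpoly
  have hF : F = fun x : Fin j → Matrix (Fin n) (Fin n) ℂ => MvPolynomial.eval
      (fun p => Sum.elim x (fun i => (x i)ᴴ) p.1 p.2.1 p.2.2) P := funext hP
  exact range_inv_mem F (hF ▸ poly_mem hn P) hinv
end

section
/- Hilbert finiteness for simultaneous conjugation: for all j, n ≥ 1, the subalgebra of MvPolynomial (Fin j × Fin n × Fin n) ℂ consisting of all polynomials P that are invariant under simultaneous conjugation — i.e. for every invertible g ∈ GL(n,ℂ) and every tuple x : Fin j → Matrix (Fin n) (Fin n) ℂ, the evaluation of P at (i ↦ g · (x i) · g⁻¹) equals its evaluation at x — is a finitely generated ℂ-algebra. -/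
open Matrix

/-- The subalgebra of polynomials in the entries of `j` generic `n × n` complex
matrices that are invariant under simultaneous conjugation by all
`g ∈ GL(n,ℂ)`. -/
noncomputable def simultaneousConjugationInvariants (j n : ℕ) :
    Subalgebra ℂ (MvPolynomial (Fin j × Fin n × Fin n) ℂ) where
  carrier := {P : MvPolynomial (Fin j × Fin n × Fin n) ℂ |
    ∀ (g : GL (Fin n) ℂ) (x : Fin j → Matrix (Fin n) (Fin n) ℂ),
      MvPolynomial.eval
        (fun p => ((g : Matrix (Fin n) (Fin n) ℂ) * x p.1 *
          ((g⁻¹ : GL (Fin n) ℂ) : Matrix (Fin n) (Fin n) ℂ)) p.2.1 p.2.2) P =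
      MvPolynomial.eval (fun p => x p.1 p.2.1 p.2.2) P}
  mul_mem' := fun hP hQ => by
    intro g x
    simp only [_root_.map_mul]
    rw [hP g x, hQ g x]
  add_mem' := fun hP hQ => by
    intro g x
    simp only [_root_.map_add]
    rw [hP g x, hQ g x]
  algebraMap_mem' := fun r => by
    intro g x
    simp [MvPolynomial.algebraMap_eq]

open MvPolynomial MeasureTheory in
theorem homComp_mul_hom {σ : Type*} (q x : MvPolynomial σ ℂ) (e d : ℕ) (hx : x.IsHomogeneous e) :
    homogeneousComponent d (q * x) =
      if e ≤ d then homogeneousComponent (d - e) q * x else 0 := by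
  have h : ∀ i, homogeneousComponent d (homogeneousComponent i q * x) =
      if i + e = d then homogeneousComponent i q * x else 0 := by
    intro i
    have := ((homogeneousComponent_isHomogeneous i q).mul hx)
    rw [homogeneousComponent_of_mem ((mem_homogeneousSubmodule _ _).2 this)]
    simp only [eq_comm]
  conv_lhs => rw [← sum_homogeneousComponent q, Finset.sum_mul, map_sum]
  simp only [h]
  split_ifs with hed
  · rw [Finset.sum_eq_single (d - e)]
    · simp [Nat.sub_add_cancel hed]
    · intro b _ hb
      rw [if_neg]; omega
    · intro hb
      rw [homogeneousComponent_eq_zero]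
      · simp
      · simp at hb
        omega
  · apply Finset.sum_eq_zero
    intro i _
    rw [if_neg]; omega

open MvPolynomial in
/-- Hilbert's argument, for a graded subalgebra with a Reynolds operator. -/
theorem hilbert_fg {σ : Type*} [Finite σ] (A : Subalgebra ℂ (MvPolynomial σ ℂ))
    (hcomp : ∀ f ∈ A, ∀ d, homogeneousComponent d f ∈ A)
    (R : MvPolynomial σ ℂ →+ MvPolynomial σ ℂ)
    (hRmem : ∀ f, R f ∈ A) (hRid : ∀ f ∈ A, R f = f)
    (hRmul : ∀ f ∈ A, ∀ h, R (h * f) = R h * f) : A.FG := by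
  classical
  let s : Set (MvPolynomial σ ℂ) := {f | f ∈ A ∧ ∃ e, 0 < e ∧ f.IsHomogeneous e}
  obtain ⟨t, hts, hspan⟩ := (Submodule.fg_span_iff_fg_span_finset_subset (R := MvPolynomial σ ℂ) s).1
    (IsNoetherian.noetherian _)
  have key : ∀ d, ∀ f ∈ A, f.IsHomogeneous d → f ∈ Algebra.adjoin ℂ (t : Set (MvPolynomial σ ℂ)) := by
    intro d
    induction d using Nat.strong_induction_on with
    | _ d ih =>
      intro f hfA hfd
      rcases Nat.eq_zero_or_pos d with rfl | hd
      · have : f = C (coeff 0 f) := by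
          rw [← totalDegree_eq_zero_iff_eq_C]
          exact (totalDegree_zero_iff_isHomogeneous _).2 hfd
        rw [this]
        exact Subalgebra.algebraMap_mem _ _
      · have hf : f ∈ Submodule.span (MvPolynomial σ ℂ) (t : Set (MvPolynomial σ ℂ)) := by
          rw [← hspan]
          exact Submodule.subset_span ⟨hfA, d, hd, hfd⟩
        obtain ⟨c, -, hc⟩ := Submodule.mem_span_finset.1 hf
        have h1 : f = ∑ x ∈ t, R (c x) * x := by
          rw [← hRid f hfA, ← hc, map_sum]
          apply Finset.sum_congr rfl
          intro x hx
          rw [smul_eq_mul, hRmul x (hts hx).1]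
        have h2 : f = ∑ x ∈ t, homogeneousComponent d (R (c x) * x) := by
          rw [← map_sum, ← h1, homogeneousComponent_of_mem
            (by simpa [mem_homogeneousSubmodule] using hfd), if_pos rfl]
        rw [h2]
        refine Subalgebra.sum_mem _ fun x hx => ?_
        obtain ⟨hxA, e, he, hxe⟩ := hts hx
        rw [homComp_mul_hom _ _ _ _ hxe]
        split_ifs with hed
        · refine Subalgebra.mul_mem _ ?_ (Algebra.subset_adjoin hx)
          exact ih (d - e) (by omega) _ (hcomp _ (hRmem _) _)
            (homogeneousComponent_isHomogeneous _ _)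
        · exact Subalgebra.zero_mem _
  refine ⟨t, le_antisymm (Algebra.adjoin_le fun x hx => (hts hx).1) fun f hf => ?_⟩
  rw [← sum_homogeneousComponent f]
  exact Subalgebra.sum_mem _ fun i _ => key i _ (hcomp f hf i) (homogeneousComponent_isHomogeneous _ _)

/-- Action of a pair of matrices on points: `x i ↦ A * x i * B`. -/
def cjPt {j n : ℕ} (A B : Matrix (Fin n) (Fin n) ℂ) (x : Fin j × Fin n × Fin n → ℂ) :
    Fin j × Fin n × Fin n → ℂ :=
  fun p => (A * Matrix.of (fun a b => x (p.1, a, b)) * B) p.2.1 p.2.2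

theorem cjPt_cjPt {j n : ℕ} (A B A' B' : Matrix (Fin n) (Fin n) ℂ)
    (x : Fin j × Fin n × Fin n → ℂ) : cjPt A B (cjPt A' B' x) = cjPt (A * A') (B' * B) x := by
  funext p
  have : Matrix.of (fun a b => cjPt A' B' x (p.1, a, b)) =
      A' * Matrix.of (fun a b => x (p.1, a, b)) * B' := by
    ext a b; rfl
  simp only [cjPt] at this ⊢
  rw [this]
  simp only [Matrix.mul_assoc]

theorem cjPt_one {j n : ℕ} (x : Fin j × Fin n × Fin n → ℂ) : cjPt 1 1 x = x := by
  funext p; simp [cjPt]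

theorem cjPt_apply {j n : ℕ} (A B : Matrix (Fin n) (Fin n) ℂ)
    (x : Fin j × Fin n × Fin n → ℂ) (p) :
    cjPt A B x p = ∑ d, ∑ c, A p.2.1 c * B d p.2.2 * x (p.1, c, d) := by
  simp only [cjPt, Matrix.mul_apply, Finset.sum_mul, Matrix.of_apply]
  exact Finset.sum_congr rfl fun d _ => Finset.sum_congr rfl fun c _ => by ring

theorem mem_inv_iff {j n : ℕ} (P : MvPolynomial (Fin j × Fin n × Fin n) ℂ) :
    P ∈ simultaneousConjugationInvariants j n ↔ ∀ (g : GL (Fin n) ℂ) (x : Fin j × Fin n × Fin n → ℂ),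
      MvPolynomial.eval (cjPt (g : Matrix (Fin n) (Fin n) ℂ)
        ((g⁻¹ : GL (Fin n) ℂ) : Matrix (Fin n) (Fin n) ℂ) x) P = MvPolynomial.eval x P := by
  constructor
  · intro h g x
    exact h g (fun i => Matrix.of fun a b => x (i, a, b))
  · intro h g x
    exact h g (fun p => x p.1 p.2.1 p.2.2)

open MvPolynomial in
/-- The polynomial action. -/
noncomputable def cjPoly {j n : ℕ} (A B : Matrix (Fin n) (Fin n) ℂ) :
    MvPolynomial (Fin j × Fin n × Fin n) ℂ →ₐ[ℂ] MvPolynomial (Fin j × Fin n × Fin n) ℂ :=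
  aeval (fun p => ∑ d, ∑ c, C (A p.2.1 c * B d p.2.2) * X (p.1, c, d))

open MvPolynomial in
theorem eval_cjPoly {j n : ℕ} (A B : Matrix (Fin n) (Fin n) ℂ) (x : Fin j × Fin n × Fin n → ℂ)
    (P : MvPolynomial (Fin j × Fin n × Fin n) ℂ) :
    eval x (cjPoly A B P) = eval (cjPt A B x) P := by
  induction P using MvPolynomial.induction_on with
  | C a => simp [cjPoly]
  | add p q hp hq => simp only [map_add, hp, hq]
  | mul_X p i hp =>
    simp only [map_mul, hp, eval_X]
    simp [cjPoly, cjPt_apply]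

open MvPolynomial in
theorem cjPoly_homComp {j n : ℕ} (A B : Matrix (Fin n) (Fin n) ℂ)
    (P : MvPolynomial (Fin j × Fin n × Fin n) ℂ) (d : ℕ) :
    cjPoly A B (homogeneousComponent d P) = homogeneousComponent d (cjPoly A B P) := by
  have hh : ∀ i, (cjPoly A B (homogeneousComponent i P)).IsHomogeneous i := by
    intro i
    have h := (homogeneousComponent_isHomogeneous i P).aeval
      (fun p : Fin j × Fin n × Fin n => ∑ d, ∑ c, C (A p.2.1 c * B d p.2.2) * X (R := ℂ) (p.1, c, d))
      (n := 1) (by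
        intro p
        refine IsHomogeneous.sum _ _ _ fun d _ => IsHomogeneous.sum _ _ _ fun c _ => ?_
        exact (isHomogeneous_C_mul_X _ _))
    simpa [cjPoly] using h
  conv_rhs => rw [← sum_homogeneousComponent P, map_sum, map_sum]
  have h2 : ∀ i, homogeneousComponent d (cjPoly A B (homogeneousComponent i P)) =
      if i = d then cjPoly A B (homogeneousComponent i P) else 0 := by
    intro i
    rw [homogeneousComponent_of_mem ((mem_homogeneousSubmodule _ _).2 (hh i))]
    simp only [eq_comm]
  simp only [h2]
  rw [Finset.sum_eq_single d]
  · simp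
  · intro b _ hb; rw [if_neg hb]
  · intro hb
    rw [homogeneousComponent_eq_zero]
    · simp
    · simpa using hb

open MvPolynomial in
theorem inv_homComp {j n : ℕ} (P : MvPolynomial (Fin j × Fin n × Fin n) ℂ)
    (hP : P ∈ simultaneousConjugationInvariants j n) (d : ℕ) :
    homogeneousComponent d P ∈ simultaneousConjugationInvariants j n := by
  rw [mem_inv_iff] at hP ⊢
  intro g x
  rw [← eval_cjPoly, cjPoly_homComp]
  congr 2
  apply MvPolynomial.funext
  intro y
  rw [eval_cjPoly, hP]

/-- Diagonal positive matrices. -/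
theorem diag_invariance {j n : ℕ} (P : MvPolynomial (Fin j × Fin n × Fin n) ℂ)
    (hP : ∀ (u : Matrix.unitaryGroup (Fin n) ℂ) (x : Fin j × Fin n × Fin n → ℂ),
      MvPolynomial.eval (cjPt (u : Matrix (Fin n) (Fin n) ℂ) (star (u : Matrix (Fin n) (Fin n) ℂ)) x) P
        = MvPolynomial.eval x P) (h : Fin n → ℝ) (x : Fin j × Fin n × Fin n → ℂ) :
    MvPolynomial.eval (cjPt (Matrix.diagonal fun a => Complex.exp (h a))
      (Matrix.diagonal fun a => Complex.exp (-h a)) x) P = MvPolynomial.eval x P := by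
  have hc : ∀ z : ℂ, cjPt (Matrix.diagonal fun a => Complex.exp (z * h a))
      (Matrix.diagonal fun a => Complex.exp (-(z * h a))) x =
      fun p => Complex.exp (z * h p.2.1) * x p * Complex.exp (-(z * h p.2.2)) := by
    intro z
    funext p
    simp [cjPt, Matrix.diagonal_mul, Matrix.mul_diagonal]
  have hent : Differentiable ℂ (fun z : ℂ => MvPolynomial.eval (fun p : Fin j × Fin n × Fin n =>
      Complex.exp (z * h p.2.1) * x p * Complex.exp (-(z * h p.2.2))) P) := by
    simp only [MvPolynomial.eval_eq]
    fun_prop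
  have heq := AnalyticOnNhd.eq_of_frequently_eq (z₀ := (0:ℂ))
    (f := (fun z : ℂ => MvPolynomial.eval (fun p : Fin j × Fin n × Fin n =>
      Complex.exp (z * h p.2.1) * x p * Complex.exp (-(z * h p.2.2))) P))
    (g := fun _ => MvPolynomial.eval x P)
    (hent.differentiableOn.analyticOnNhd isOpen_univ) analyticOnNhd_const (by
      have ht : Filter.Tendsto (fun k : ℕ => Complex.I * (((1 / ((k : ℝ) + 1) : ℝ)) : ℂ)) Filter.atTop
          (nhdsWithin 0 {0}ᶜ) := by
        rw [tendsto_nhdsWithin_iff]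
        constructor
        · have := (Complex.continuous_ofReal.tendsto 0).comp
            (tendsto_one_div_add_atTop_nhds_zero_nat (𝕜 := ℝ))
          simpa using this.const_mul Complex.I
        · refine Filter.Eventually.of_forall fun k => ?_
          have : ((k : ℂ) + 1) ≠ 0 := by exact_mod_cast Nat.succ_ne_zero k
          simp [this]
      refine ht.frequently (Filter.Frequently.of_forall fun k => ?_)
      generalize (1 / ((k : ℝ) + 1) : ℝ) = t
      have hst : ∀ a, (starRingEnd ℂ) (Complex.exp (Complex.I * t * h a)) =
          Complex.exp (-(Complex.I * t * h a)) := by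
        intro a
        rw [← Complex.exp_conj]; simp
      have hs : star (Matrix.diagonal fun a => Complex.exp (Complex.I * t * h a)) =
          (Matrix.diagonal fun a => Complex.exp (-(Complex.I * t * h a))) := by
        rw [Matrix.star_eq_conjTranspose, Matrix.diagonal_conjTranspose]
        congr 1
        funext a
        simpa using hst a
      have := hP ⟨Matrix.diagonal fun a => Complex.exp (Complex.I * t * h a), by
        rw [Matrix.mem_unitaryGroup_iff, hs, Matrix.diagonal_mul_diagonal]
        simp [← Complex.exp_add]⟩ x
      simp only [hs] at this
      rw [hc] at this
      exact this)
  have := congrFun heq 1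
  rw [← hc] at this
  simpa using this

open ComplexOrder in
theorem svd {n : ℕ} (g : GL (Fin n) ℂ) : ∃ (u v : Matrix.unitaryGroup (Fin n) ℂ) (h : Fin n → ℝ),
    (g : Matrix (Fin n) (Fin n) ℂ) = u * Matrix.diagonal (fun a => Complex.exp (h a)) *
      star (v : Matrix (Fin n) (Fin n) ℂ) := by
  set G : Matrix (Fin n) (Fin n) ℂ := (g : Matrix (Fin n) (Fin n) ℂ) with hG
  have hGu : IsUnit G := g.isUnit
  have hpd : (Gᴴ * G).PosDef := Matrix.PosDef.conjTranspose_mul_self G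
    (Matrix.mulVec_injective_of_isUnit hGu)
  set v := hpd.isHermitian.eigenvectorUnitary
  have hpos := hpd.eigenvalues_pos
  have hsp := hpd.isHermitian.spectral_theorem
  set lam := hpd.isHermitian.eigenvalues
  let h : Fin n → ℝ := fun a => Real.log (lam a) / 2
  let V : Matrix (Fin n) (Fin n) ℂ := v
  have hV1 : star V * V = 1 := Matrix.mem_unitaryGroup_iff'.1 v.2
  have hV2 : V * star V = 1 := Matrix.mem_unitaryGroup_iff.1 v.2
  have hsp' : star V * (star G * G) * V = Matrix.diagonal (fun a => (lam a : ℂ)) := by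
    have : star G * G = V * Matrix.diagonal (fun a => (lam a : ℂ)) * star V := hsp
    rw [this]
    simp only [← mul_assoc, hV1, one_mul]
    rw [mul_assoc, hV1, mul_one]
  let E : Matrix (Fin n) (Fin n) ℂ := Matrix.diagonal (fun a => Complex.exp (h a))
  let E' : Matrix (Fin n) (Fin n) ℂ := Matrix.diagonal (fun a => Complex.exp (-h a))
  have hE : E' * E = 1 := by
    simp [E, E', Matrix.diagonal_mul_diagonal, ← Complex.exp_add]
  have hsE : star E' = E' := by
    simp only [E']
    rw [Matrix.star_eq_conjTranspose, Matrix.diagonal_conjTranspose]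
    congr 1
    funext a
    have : (starRingEnd ℂ) (Complex.exp (-h a)) = Complex.exp (-h a) := by
      rw [← Complex.exp_conj]; simp
    simpa using this
  have hu : star (G * V * E') * (G * V * E') = 1 := by
    have : star (G * V * E') * (G * V * E') = E' * (star V * (star G * G) * V) * E' := by
      simp only [star_mul, hsE, mul_assoc]
    rw [this, hsp']
    simp only [E', Matrix.diagonal_mul_diagonal]
    rw [← Matrix.diagonal_one]
    congr 1
    funext a
    have hl : (lam a : ℂ) = Complex.exp (h a) * Complex.exp (h a) := by
      rw [← Complex.exp_add]
      norm_cast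
      simp only [h]
      rw [add_halves, Real.exp_log (hpos a)]
    rw [hl]
    have : Complex.exp (-h a) * Complex.exp (h a) = 1 := by simp [← Complex.exp_add]
    linear_combination (Complex.exp (-h a) * Complex.exp (h a) + 1) * this
  refine ⟨⟨G * V * E', Matrix.mem_unitaryGroup_iff'.2 hu⟩, v, h, ?_⟩
  change G = G * V * E' * E * star V
  rw [mul_assoc (G * V), hE, mul_one, mul_assoc, hV2, mul_one]

theorem unitary_trick {j n : ℕ} (P : MvPolynomial (Fin j × Fin n × Fin n) ℂ)
    (hP : ∀ (u : Matrix.unitaryGroup (Fin n) ℂ) (x : Fin j × Fin n × Fin n → ℂ),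
      MvPolynomial.eval (cjPt (u : Matrix (Fin n) (Fin n) ℂ) (star (u : Matrix (Fin n) (Fin n) ℂ)) x) P
        = MvPolynomial.eval x P) : P ∈ simultaneousConjugationInvariants j n := by
  rw [mem_inv_iff]
  intro g x
  obtain ⟨u, v, h, hg⟩ := svd g
  let U : Matrix (Fin n) (Fin n) ℂ := u
  let V : Matrix (Fin n) (Fin n) ℂ := v
  have hV1 : star V * V = 1 := Matrix.mem_unitaryGroup_iff'.1 v.2
  have hU2 : U * star U = 1 := Matrix.mem_unitaryGroup_iff.1 u.2
  have hE : (Matrix.diagonal (fun a => Complex.exp (h a)) : Matrix (Fin n) (Fin n) ℂ) *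
      Matrix.diagonal (fun a => Complex.exp (-h a)) = 1 := by
    simp [Matrix.diagonal_mul_diagonal, ← Complex.exp_add]
  have hinv : ((g⁻¹ : GL (Fin n) ℂ) : Matrix (Fin n) (Fin n) ℂ) =
      V * (Matrix.diagonal (fun a => Complex.exp (-h a)) * star U) := by
    rw [Matrix.coe_units_inv]
    apply Matrix.inv_eq_right_inv
    rw [hg]
    change U * _ * star V * _ = 1
    rw [mul_assoc _ (star V), ← mul_assoc (star V), hV1, one_mul, mul_assoc U, ← mul_assoc _ _ (star U),
      hE, one_mul, hU2]
  rw [hinv, hg, mul_assoc, ← mul_assoc V]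
  change MvPolynomial.eval (cjPt (U * (_ * star V)) (V * _ * star U) x) P = _
  rw [← cjPt_cjPt, hP u, ← cjPt_cjPt, diag_invariance P hP]
  have := hP (star v) x
  simpa using this

theorem compact_unitary (n : ℕ) : CompactSpace (Matrix.unitaryGroup (Fin n) ℂ) := by
  apply isCompact_iff_compactSpace.1
  have hK : IsCompact (Set.pi Set.univ fun _ : Fin n => Set.pi Set.univ fun _ : Fin n =>
      Metric.closedBall (0 : ℂ) 1) :=
    isCompact_univ_pi fun _ => isCompact_univ_pi fun _ => isCompact_closedBall _ _
  refine IsCompact.of_isClosed_subset (s := Set.pi Set.univ fun _ : Fin n => Set.pi Set.univ fun _ : Fin n =>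
      Metric.closedBall (0 : ℂ) 1) hK ?_ ?_
  · have : ((Matrix.unitaryGroup (Fin n) ℂ : Submonoid (Matrix (Fin n) (Fin n) ℂ)) :
        Set (Matrix (Fin n) (Fin n) ℂ)) = {U | U * star U = 1} := by
      ext U; exact Matrix.mem_unitaryGroup_iff
    rw [this]
    exact isClosed_eq (by fun_prop) continuous_const
  · intro U hU a _ b _
    simpa using entry_norm_bound_of_unitary hU a b

/-- Evaluation of continuous functions at a point. -/
noncomputable def evRH {K : Type*} [TopologicalSpace K] (u : K) : C(K, ℂ) →+* ℂ :=
  (Pi.evalRingHom (fun _ : K => ℂ) u).comp ContinuousMap.coeFnRingHom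

@[simp] theorem evRH_apply {K : Type*} [TopologicalSpace K] (u : K) (f : C(K, ℂ)) :
    evRH u f = f u := rfl

open MvPolynomial MeasureTheory in
theorem integral_poly {K σ : Type*} [TopologicalSpace K] [CompactSpace K] [MeasurableSpace K]
    [BorelSpace K] (μ : Measure K) [IsFiniteMeasure μ]
    (F : MvPolynomial σ C(K, ℂ)) :
    ∃ Q : MvPolynomial σ ℂ, ∀ x : σ → ℂ,
      Integrable (fun u => eval x (map (evRH u) F)) μ ∧
      eval x Q = ∫ u, eval x (map (evRH u) F) ∂μ := by
  induction F using MvPolynomial.induction_on' with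
  | monomial m a =>
    refine ⟨monomial m (∫ u, a u ∂μ), fun x => ?_⟩
    simp only [map_monomial, eval_monomial]
    have hi : Integrable (fun u => a u) μ :=
      a.continuous.integrable_of_hasCompactSupport (HasCompactSupport.of_compactSpace _)
    constructor
    · exact hi.mul_const _
    · rw [← integral_mul_const]; rfl
  | add p q hp hq =>
    obtain ⟨Q1, h1⟩ := hp
    obtain ⟨Q2, h2⟩ := hq
    refine ⟨Q1 + Q2, fun x => ?_⟩
    simp only [map_add]
    exact ⟨(h1 x).1.add (h2 x).1, by rw [integral_add (h1 x).1 (h2 x).1, (h1 x).2, (h2 x).2]⟩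

open MvPolynomial MeasureTheory in
theorem reynolds_exists {j n : ℕ} [MeasurableSpace (Matrix.unitaryGroup (Fin n) ℂ)]
    [BorelSpace (Matrix.unitaryGroup (Fin n) ℂ)] [CompactSpace (Matrix.unitaryGroup (Fin n) ℂ)]
    (μ : Measure (Matrix.unitaryGroup (Fin n) ℂ)) [IsFiniteMeasure μ]
    (P : MvPolynomial (Fin j × Fin n × Fin n) ℂ) :
    ∃ Q : MvPolynomial (Fin j × Fin n × Fin n) ℂ, ∀ x,
      Integrable (fun u : Matrix.unitaryGroup (Fin n) ℂ => eval
        (cjPt (star (u : Matrix (Fin n) (Fin n) ℂ)) (u : Matrix (Fin n) (Fin n) ℂ) x) P) μ ∧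
      eval x Q = ∫ u : Matrix.unitaryGroup (Fin n) ℂ, eval
        (cjPt (star (u : Matrix (Fin n) (Fin n) ℂ)) (u : Matrix (Fin n) (Fin n) ℂ) x) P ∂μ := by
  let co (a b c d : Fin n) : C(Matrix.unitaryGroup (Fin n) ℂ, ℂ) :=
    ⟨fun u => star (u : Matrix (Fin n) (Fin n) ℂ) a c * (u : Matrix (Fin n) (Fin n) ℂ) d b, by
      have h : Continuous fun u : Matrix.unitaryGroup (Fin n) ℂ => (u : Matrix (Fin n) (Fin n) ℂ) :=
        continuous_subtype_val
      exact (h.star.matrix_elem a c).mul (h.matrix_elem d b)⟩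
  let F : MvPolynomial (Fin j × Fin n × Fin n) C(Matrix.unitaryGroup (Fin n) ℂ, ℂ) :=
    aeval (fun p => ∑ d, ∑ c, C (co p.2.1 p.2.2 c d) * X (p.1, c, d)) P
  have hF : ∀ (u : Matrix.unitaryGroup (Fin n) ℂ) x, eval x (map (evRH u) F) =
      eval (cjPt (star (u : Matrix (Fin n) (Fin n) ℂ)) (u : Matrix (Fin n) (Fin n) ℂ) x) P := by
    intro u x
    simp only [F]
    induction P using MvPolynomial.induction_on with
    | C a => simp [MvPolynomial.algebraMap_apply]
    | add p q hp hq => simp only [map_add, hp, hq]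
    | mul_X p i hp =>
      simp only [map_mul, hp, eval_X]
      simp [cjPt_apply, co]
  obtain ⟨Q, hQ⟩ := integral_poly μ F
  refine ⟨Q, fun x => ?_⟩
  simpa only [hF] using hQ x

open MvPolynomial MeasureTheory in
theorem simultaneousConjugationInvariants_fg_aux (j n : ℕ) :
    (simultaneousConjugationInvariants j n).FG := by
  haveI := compact_unitary n
  letI : MeasurableSpace (Matrix.unitaryGroup (Fin n) ℂ) := borel _
  haveI : BorelSpace (Matrix.unitaryGroup (Fin n) ℂ) := ⟨rfl⟩
  let μ : Measure (Matrix.unitaryGroup (Fin n) ℂ) := Measure.haarMeasure ⊤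
  haveI : IsProbabilityMeasure μ := ⟨by
    have := Measure.haarMeasure_self (K₀ := (⊤ : TopologicalSpace.PositiveCompacts (Matrix.unitaryGroup (Fin n) ℂ)))
    simpa using this⟩
  choose R hR using fun P : MvPolynomial (Fin j × Fin n × Fin n) ℂ => reynolds_exists μ P
  have hinv : ∀ f ∈ simultaneousConjugationInvariants j n, ∀ (u : Matrix.unitaryGroup (Fin n) ℂ) x,
      eval (cjPt (star (u : Matrix (Fin n) (Fin n) ℂ)) (u : Matrix (Fin n) (Fin n) ℂ) x) f =
        eval x f := by
    intro f hf u x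
    have h1 := Matrix.mem_unitaryGroup_iff.1 u.2
    have h2 := Matrix.mem_unitaryGroup_iff'.1 u.2
    exact (mem_inv_iff f).1 hf ⟨star (u : Matrix (Fin n) (Fin n) ℂ), u, h2, h1⟩ x
  refine hilbert_fg _ inv_homComp ⟨⟨R, ?_⟩, ?_⟩ ?_ ?_ ?_
  · apply MvPolynomial.funext
    intro x
    simp [(hR _ x).2]
  · intro P Q
    apply MvPolynomial.funext
    intro x
    simp only [map_add, (hR _ x).2]
    rw [integral_add (hR P x).1 (hR Q x).1]
  · intro P
    apply unitary_trick
    intro v x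
    change eval _ (R P) = eval _ (R P)
    rw [(hR P _).2, (hR P _).2,
      ← integral_mul_left_eq_self (μ := μ) (fun u : Matrix.unitaryGroup (Fin n) ℂ => eval
        (cjPt (star (u : Matrix (Fin n) (Fin n) ℂ)) (u : Matrix (Fin n) (Fin n) ℂ) x) P) (star v)]
    congr 1
    funext u
    rw [cjPt_cjPt]
    simp
  · intro f hf
    apply MvPolynomial.funext
    intro x
    change eval _ (R f) = _
    rw [(hR f _).2]
    simp [hinv f hf]
  · intro f hf h
    apply MvPolynomial.funext
    intro x
    change eval _ (R _) = eval _ (R _ * _)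
    rw [map_mul, (hR _ _).2, (hR _ _).2, ← integral_mul_const]
    simp [hinv f hf]

/-- Hilbert finiteness for simultaneous conjugation: for all `j, n ≥ 1`, the
algebra of polynomials in the entries of `j` generic `n × n` complex matrices
invariant under simultaneous conjugation by `GL(n,ℂ)` is a finitely generated
ℂ-algebra. -/
theorem simultaneousConjugationInvariants_fg (j n : ℕ) (hj : 1 ≤ j) (hn : 1 ≤ n) :
    (simultaneousConjugationInvariants j n).FG := by
  exact simultaneousConjugationInvariants_fg_aux j n
end

section
/- Finite generation of the ring of leptonic flavor invariants (three-generation case): the subalgebra of MvPolynomial (Fin 4 × Fin 3 × Fin 3) ℂ consisting of all polynomials P in the entries of four generic 3×3 matrices such that, for every unitary U ∈ U(3,ℂ) and every quadruple H : Fin 4 → Matrix (Fin 3) (Fin 3) ℂ of Hermitian matrices, the evaluation of P at (i ↦ U · (H i) · Uᴴ) equals its evaluation at H, is a finitely generated ℂ-algebra. (This is the ring of flavor invariants of the Hermitian matrices {H_l, H_ν, G_{lν}^{(1)}, G_{lν}^{(2)}} under unitary flavor basis transformations.) -/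
open Matrix

/-- The ring of leptonic flavor invariants in the three-generation scenario:
the subalgebra of polynomials in the entries of four generic `3 × 3` matrices
whose value is unchanged when any quadruple of Hermitian matrices
`{H_l, H_ν, G_{lν}^{(1)}, G_{lν}^{(2)}}` is simultaneously conjugated by any
unitary matrix `U ∈ U(3,ℂ)`. -/
noncomputable def flavorInvariants :
    Subalgebra ℂ (MvPolynomial (Fin 4 × Fin 3 × Fin 3) ℂ) where
  carrier := {P : MvPolynomial (Fin 4 × Fin 3 × Fin 3) ℂ |
    ∀ U ∈ Matrix.unitaryGroup (Fin 3) ℂ,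
      ∀ H : Fin 4 → Matrix (Fin 3) (Fin 3) ℂ, (∀ i, (H i).IsHermitian) →
        MvPolynomial.eval (fun p => (U * H p.1 * Uᴴ) p.2.1 p.2.2) P =
        MvPolynomial.eval (fun p => H p.1 p.2.1 p.2.2) P}
  mul_mem' := fun hP hQ => by
    intro U hU H hH
    simp only [_root_.map_mul]
    rw [hP U hU H hH, hQ U hU H hH]
  add_mem' := fun hP hQ => by
    intro U hU H hH
    simp only [_root_.map_add]
    rw [hP U hU H hH, hQ U hU H hH]
  algebraMap_mem' := fun r => by
    intro U hU H hH
    simp [MvPolynomial.algebraMap_eq]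

/-- Components of a product with a homogeneous factor. -/
theorem component_mul {σ : Type} (q a : MvPolynomial σ ℂ) (d n : ℕ) (ha : a.IsHomogeneous d) :
    MvPolynomial.homogeneousComponent n (q * a) =
      if d ≤ n then MvPolynomial.homogeneousComponent (n - d) q * a else 0 := by
  have : ∀ i, MvPolynomial.homogeneousComponent n (MvPolynomial.homogeneousComponent i q * a) =
      if i + d = n then MvPolynomial.homogeneousComponent i q * a else 0 := by
    intro i
    rw [MvPolynomial.homogeneousComponent_of_mem
      ((MvPolynomial.homogeneousComponent_isHomogeneous i q).mul ha)]
    simp only [eq_comm]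
  conv_lhs => rw [← MvPolynomial.sum_homogeneousComponent q]
  rw [Finset.sum_mul, map_sum]
  simp only [this]
  split_ifs with h
  · have e : ∀ i, (i + d = n) = (i = n - d) := fun i => propext (by omega)
    simp only [e]
    rw [Finset.sum_ite_eq']
    split_ifs with h
    · rfl
    · rw [MvPolynomial.homogeneousComponent_eq_zero, zero_mul]
      simp only [Finset.mem_range] at h
      omega
  · exact Finset.sum_eq_zero fun i _ => if_neg (by omega)

/-- Hilbert's argument: a subalgebra of a polynomial ring with a graded Reynolds operator
is finitely generated. -/
theorem hilbert_fg_s10 {σ : Type} [Finite σ] (S : Subalgebra ℂ (MvPolynomial σ ℂ))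
    (R : MvPolynomial σ ℂ →ₗ[ℂ] MvPolynomial σ ℂ) (hmem : ∀ P, R P ∈ S)
    (hmul : ∀ f ∈ S, ∀ h, R (h * f) = R h * f) (h1 : R 1 = 1)
    (hhom : ∀ n P, MvPolynomial.IsHomogeneous P n → MvPolynomial.IsHomogeneous (R P) n) :
    S.FG := by
  classical
  have hfix : ∀ f ∈ S, R f = f := by
    intro f hf
    have := hmul f hf 1
    simpa [h1] using this
  have hcomp : ∀ f ∈ S, ∀ n, MvPolynomial.homogeneousComponent n f ∈ S := by
    intro f hf n
    have e : MvPolynomial.homogeneousComponent n f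
        = R (MvPolynomial.homogeneousComponent n f) := by
      conv_lhs => rw [← hfix f hf, ← MvPolynomial.sum_homogeneousComponent f]
      rw [map_sum, map_sum]
      have : ∀ i, MvPolynomial.homogeneousComponent n
          (R (MvPolynomial.homogeneousComponent i f)) =
          if i = n then R (MvPolynomial.homogeneousComponent i f) else 0 := by
        intro i
        rw [MvPolynomial.homogeneousComponent_of_mem
          (hhom i _ (MvPolynomial.homogeneousComponent_isHomogeneous i f))]
        simp only [eq_comm]
      simp only [this]
      rw [Finset.sum_ite_eq']
      split_ifs with h
      · rfl
      · rw [MvPolynomial.homogeneousComponent_eq_zero, map_zero]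
        simpa using h
    rw [e]; exact hmem _
  set B : Set (MvPolynomial σ ℂ) := {f | f ∈ S ∧ ∃ n, 0 < n ∧ f.IsHomogeneous n} with hB
  obtain ⟨t, htB, ht⟩ := (Submodule.fg_span_iff_fg_span_finset_subset (R := MvPolynomial σ ℂ) B).1
    (IsNoetherian.noetherian _)
  have key : ∀ n, ∀ f ∈ S, f.IsHomogeneous n → f ∈ Algebra.adjoin ℂ (t : Set (MvPolynomial σ ℂ)) := by
    intro n
    induction n using Nat.strong_induction_on with
    | _ n ih =>
      intro f hf hn
      rcases Nat.eq_zero_or_pos n with h0 | hpos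
      · subst h0
        have : f = MvPolynomial.C (f.coeff 0) := by
          rw [← MvPolynomial.homogeneousComponent_zero, MvPolynomial.homogeneousComponent_eq_self hn]
        rw [this]
        exact Subalgebra.algebraMap_mem _ _
      · have hfs : f ∈ Submodule.span (MvPolynomial σ ℂ) (t : Set (MvPolynomial σ ℂ)) := by
          rw [← ht]; exact Submodule.subset_span ⟨hf, n, hpos, hn⟩
        obtain ⟨c, -, hc⟩ := Submodule.mem_span_finset.1 hfs
        have e : f = ∑ a ∈ t, MvPolynomial.homogeneousComponent n (R (c a) * a) := by
          rw [← map_sum]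
          conv_lhs => rw [← MvPolynomial.homogeneousComponent_eq_self hn, ← hfix f hf, ← hc, map_sum]
          congr 1
          refine Finset.sum_congr rfl fun a ha => ?_
          rw [smul_eq_mul, hmul a (htB ha).1]
        rw [e]
        refine Subalgebra.sum_mem _ fun a ha => ?_
        obtain ⟨haS, d, hd, had⟩ := htB ha
        by_cases hdn : d ≤ n
        · have e2 : MvPolynomial.homogeneousComponent n (R (c a) * a) =
              MvPolynomial.homogeneousComponent (n - d) (R (c a)) * a := by
            rw [component_mul _ _ d n had, if_pos hdn]
          rw [e2]
          refine Subalgebra.mul_mem _ (ih (n - d) (by omega) _ (hcomp _ (hmem _) _)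
            (MvPolynomial.homogeneousComponent_isHomogeneous _ _)) (Algebra.subset_adjoin ha)
        · have e2 : MvPolynomial.homogeneousComponent n (R (c a) * a) = 0 := by
            rw [component_mul _ _ d n had, if_neg hdn]
          rw [e2]
          exact Subalgebra.zero_mem _
  refine ⟨t, le_antisymm (Algebra.adjoin_le fun a ha => (htB ha).1) fun f hf => ?_⟩
  rw [← MvPolynomial.sum_homogeneousComponent f]
  exact Subalgebra.sum_mem _ fun i _ => key i _ (hcomp f hf i)
    (MvPolynomial.homogeneousComponent_isHomogeneous _ _)

/-- Hermitian tuples are Zariski dense. -/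
theorem hermitian_dense (P Q : MvPolynomial (Fin 4 × Fin 3 × Fin 3) ℂ)
    (h : ∀ H : Fin 4 → Matrix (Fin 3) (Fin 3) ℂ, (∀ i, (H i).IsHermitian) →
      MvPolynomial.eval (fun p => H p.1 p.2.1 p.2.2) P =
      MvPolynomial.eval (fun p => H p.1 p.2.1 p.2.2) Q) : P = Q := by
  let g : Fin 4 × Fin 3 × Fin 3 → MvPolynomial (Fin 4 × Fin 3 × Fin 3) ℂ := fun p =>
    MvPolynomial.X (p.1, p.2.1, p.2.2) + MvPolynomial.X (p.1, p.2.2, p.2.1) +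
      MvPolynomial.C Complex.I *
        (MvPolynomial.X (p.1, p.2.1, p.2.2) - MvPolynomial.X (p.1, p.2.2, p.2.1))
  have hg : ∀ (F : MvPolynomial (Fin 4 × Fin 3 × Fin 3) ℂ) (x : Fin 4 × Fin 3 × Fin 3 → ℂ),
      MvPolynomial.eval x (MvPolynomial.bind₁ g F) =
      MvPolynomial.eval (fun p => x (p.1, p.2.1, p.2.2) + x (p.1, p.2.2, p.2.1) +
        Complex.I * (x (p.1, p.2.1, p.2.2) - x (p.1, p.2.2, p.2.1))) F := by
    intro F x
    induction F using MvPolynomial.induction_on with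
    | C a => simp only [MvPolynomial.bind₁_C_right, MvPolynomial.eval_C]
    | add p q hp hq => simp only [map_add, hp, hq]
    | mul_X p i hp =>
      rw [map_mul, map_mul, hp, map_mul]
      simp only [MvPolynomial.bind₁_X_right, g, map_add, map_mul, map_sub, MvPolynomial.eval_X,
        MvPolynomial.eval_C]
  have hb : MvPolynomial.bind₁ g P = MvPolynomial.bind₁ g Q := by
    refine MvPolynomial.funext_set (fun _ => Set.range (fun r : ℝ => (r : ℂ)))
      (fun _ => Set.infinite_range_of_injective Complex.ofReal_injective) fun x hx => ?_
    rw [hg, hg]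
    refine h (fun i => Matrix.of fun a b => x (i, a, b) + x (i, b, a) +
        Complex.I * (x (i, a, b) - x (i, b, a))) fun i => ?_
    have hr : ∀ p, (starRingEnd ℂ) (x p) = x p := by
      intro p
      obtain ⟨r, hr⟩ := hx p (Set.mem_univ _)
      rw [← hr]; simp
    ext a b
    simp [hr]
    ring
  apply MvPolynomial.funext
  intro z
  let x : Fin 4 × Fin 3 × Fin 3 → ℂ := fun p =>
    ((z p + z (p.1, p.2.2, p.2.1)) / 2 - Complex.I * (z p - z (p.1, p.2.2, p.2.1)) / 2) / 2
  have hz : (fun p : Fin 4 × Fin 3 × Fin 3 => x (p.1, p.2.1, p.2.2) + x (p.1, p.2.2, p.2.1) +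
        Complex.I * (x (p.1, p.2.1, p.2.2) - x (p.1, p.2.2, p.2.1))) = z := by
    funext p
    simp only [x]
    linear_combination (-(z p - z (p.1, p.2.2, p.2.1)) / 2) * Complex.I_mul_I
  rw [← hz, ← hg, ← hg, hb]

/-- The unitary group is compact. -/
theorem unitary_compact : CompactSpace (Matrix.unitaryGroup (Fin 3) ℂ) := by
  refine (isCompact_iff_compactSpace (s := ((Matrix.unitaryGroup (Fin 3) ℂ : Submonoid _) :
    Set (Matrix (Fin 3) (Fin 3) ℂ)))).1 ?_
  have hsub : ((Matrix.unitaryGroup (Fin 3) ℂ : Submonoid _) : Set (Matrix (Fin 3) (Fin 3) ℂ)) ⊆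
      (Set.univ.pi fun _ => Set.univ.pi fun _ => Metric.closedBall (0 : ℂ) 1 :
        Set (Fin 3 → Fin 3 → ℂ)) := by
    intro U hU i _ j _
    simpa using entry_norm_bound_of_unitary hU i j
  have hc : IsCompact (Set.univ.pi fun _ => Set.univ.pi fun _ => Metric.closedBall (0 : ℂ) 1 :
        Set (Fin 3 → Fin 3 → ℂ)) :=
    isCompact_univ_pi fun _ => isCompact_univ_pi fun _ => isCompact_closedBall _ _
  refine IsCompact.of_isClosed_subset (X := Matrix (Fin 3) (Fin 3) ℂ) hc ?_ hsub
  have : ((Matrix.unitaryGroup (Fin 3) ℂ : Submonoid _) : Set (Matrix (Fin 3) (Fin 3) ℂ)) =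
      {U | U * star U = 1} := by
    ext U; exact Matrix.mem_unitaryGroup_iff
  rw [this]
  exact isClosed_eq (continuous_id.mul continuous_star) continuous_const

/-- The invariant mean on a compact group. -/
theorem exists_mean (G : Type) [Group G] [TopologicalSpace G] [IsTopologicalGroup G]
    [CompactSpace G] : ∃ I : C(G, ℂ) →ₗ[ℂ] ℂ, I 1 = 1 ∧
      ∀ (f f' : C(G, ℂ)) (g : G), (∀ x, f' x = f (g * x)) → I f' = I f := by
  letI : MeasurableSpace G := borel G
  haveI : BorelSpace G := ⟨rfl⟩
  let μ : MeasureTheory.Measure G := MeasureTheory.Measure.haarMeasure ⊤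
  have hint : ∀ f : C(G, ℂ), MeasureTheory.Integrable f μ := fun f =>
    f.continuous.integrable_of_hasCompactSupport (HasCompactSupport.of_compactSpace f)
  have h1 : μ Set.univ = 1 := by
    have := MeasureTheory.Measure.haarMeasure_self (K₀ := (⊤ : TopologicalSpace.PositiveCompacts G))
    simpa [μ] using this
  refine ⟨{ toFun := fun f => ∫ x, f x ∂μ, map_add' := ?_, map_smul' := ?_ }, ?_, ?_⟩
  · intro f g
    exact MeasureTheory.integral_add (hint f) (hint g)
  · intro c f
    exact MeasureTheory.integral_smul c _
  · simp [MeasureTheory.measureReal_def, h1]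
  · intro f f' g h
    simp only [LinearMap.coe_mk, AddHom.coe_mk, h]
    exact MeasureTheory.integral_mul_left_eq_self (fun x => f x) g

/-- Applying a linear functional to the coefficients of a polynomial. -/
theorem exists_coeff_map {σ : Type} {A : Type} [Finite σ] [CommRing A] [Algebra ℂ A]
    (I : A →ₗ[ℂ] ℂ) :
    ∃ L : MvPolynomial σ A →ₗ[ℂ] MvPolynomial σ ℂ,
      (∀ Q m, (L Q).coeff m = I (Q.coeff m)) ∧
      ∀ Q x, MvPolynomial.eval x (L Q) =
        I (MvPolynomial.eval (fun p => algebraMap ℂ A (x p)) Q) := by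
  classical
  haveI := Fintype.ofFinite σ
  let L : MvPolynomial σ A → MvPolynomial σ ℂ := fun Q =>
    ∑ m ∈ Q.support, MvPolynomial.monomial m (I (Q.coeff m))
  have hL : ∀ Q m, (L Q).coeff m = I (Q.coeff m) := by
    intro Q m
    simp only [L, MvPolynomial.coeff_sum, MvPolynomial.coeff_monomial, Finset.sum_ite_eq']
    split_ifs with h
    · rfl
    · rw [MvPolynomial.notMem_support_iff.1 h, map_zero]
  refine ⟨{ toFun := L, map_add' := ?_, map_smul' := ?_ }, hL, ?_⟩
  · intro a b; ext m; simp [hL]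
  · intro c a; ext m; simp [hL]
  · intro Q x
    simp only [LinearMap.coe_mk, AddHom.coe_mk, L, map_sum, MvPolynomial.eval_eq' _ Q]
    refine Finset.sum_congr rfl fun m _ => ?_
    rw [MvPolynomial.eval_monomial, Finsupp.prod_fintype _ _ (by simp)]
    have : Q.coeff m * ∏ i, (algebraMap ℂ A (x i)) ^ m i = (∏ i, x i ^ m i) • Q.coeff m := by
      rw [Algebra.smul_def, map_prod]; simp [mul_comm]
    rw [this, map_smul, smul_eq_mul, mul_comm]

theorem flavor_reynolds : ∃ R : MvPolynomial (Fin 4 × Fin 3 × Fin 3) ℂ →ₗ[ℂ]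
      MvPolynomial (Fin 4 × Fin 3 × Fin 3) ℂ, (∀ P, R P ∈ flavorInvariants) ∧
    (∀ f ∈ flavorInvariants, ∀ h, R (h * f) = R h * f) ∧ R 1 = 1 ∧
    (∀ n P, MvPolynomial.IsHomogeneous P n → MvPolynomial.IsHomogeneous (R P) n) := by
  haveI := unitary_compact
  obtain ⟨I, hI1, hI⟩ := exists_mean (Matrix.unitaryGroup (Fin 3) ℂ)
  obtain ⟨L, hLc, hLe⟩ := exists_coeff_map (σ := Fin 4 × Fin 3 × Fin 3) I
  let u : Fin 3 → Fin 3 → C(Matrix.unitaryGroup (Fin 3) ℂ, ℂ) := fun a b =>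
    ⟨fun U => (U : Matrix (Fin 3) (Fin 3) ℂ) a b, continuous_subtype_val.matrix_elem a b⟩
  let g : Fin 4 × Fin 3 × Fin 3 →
      MvPolynomial (Fin 4 × Fin 3 × Fin 3) C(Matrix.unitaryGroup (Fin 3) ℂ, ℂ) := fun p =>
    ∑ d, ∑ c, MvPolynomial.C (star (u c p.2.1) * u d p.2.2) * MvPolynomial.X (p.1, c, d)
  let D : MvPolynomial (Fin 4 × Fin 3 × Fin 3) ℂ →ₐ[ℂ]
      MvPolynomial (Fin 4 × Fin 3 × Fin 3) C(Matrix.unitaryGroup (Fin 3) ℂ, ℂ) :=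
    MvPolynomial.aeval g
  have hD : ∀ (P) (H : Fin 4 → Matrix (Fin 3) (Fin 3) ℂ) (U : Matrix.unitaryGroup (Fin 3) ℂ),
      MvPolynomial.eval (fun p => algebraMap ℂ C(Matrix.unitaryGroup (Fin 3) ℂ, ℂ)
        (H p.1 p.2.1 p.2.2)) (D P) U =
      MvPolynomial.eval (fun p => ((U : Matrix (Fin 3) (Fin 3) ℂ)ᴴ * H p.1 * U) p.2.1 p.2.2) P := by
    intro P H U
    induction P using MvPolynomial.induction_on with
    | C a => simp [D, MvPolynomial.algebraMap_eq, MvPolynomial.algebraMap_apply]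
    | add p q hp hq => simp [hp, hq]
    | mul_X p i hp =>
      rw [map_mul, map_mul, ContinuousMap.mul_apply, hp, map_mul]
      congr 1
      simp [D, g, u, Matrix.mul_apply, Finset.sum_mul]
      refine Finset.sum_congr rfl fun d _ => Finset.sum_congr rfl fun c _ => ?_
      ring
  have hR : ∀ (P) (H : Fin 4 → Matrix (Fin 3) (Fin 3) ℂ),
      MvPolynomial.eval (fun p => H p.1 p.2.1 p.2.2) (L (D P)) =
      I (MvPolynomial.eval (fun p => algebraMap ℂ C(Matrix.unitaryGroup (Fin 3) ℂ, ℂ)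
        (H p.1 p.2.1 p.2.2)) (D P)) := fun P H => hLe _ _
  refine ⟨L ∘ₗ D.toLinearMap, ?_, ?_, ?_, ?_⟩
  · intro P V hV H hH
    simp only [LinearMap.comp_apply, AlgHom.toLinearMap_apply]
    rw [hR P H, hR P (fun i => V * H i * Vᴴ)]
    refine hI _ _ (⟨V, hV⟩⁻¹ : Matrix.unitaryGroup (Fin 3) ℂ) fun U => ?_
    rw [hD P H, hD P (fun i => V * H i * Vᴴ)]
    congr 2
    funext p
    have : (((⟨V, hV⟩⁻¹ * U : Matrix.unitaryGroup (Fin 3) ℂ)) : Matrix (Fin 3) (Fin 3) ℂ)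
        = Vᴴ * U := rfl
    rw [this]
    simp [Matrix.conjTranspose_mul, Matrix.mul_assoc]
  · intro f hf h
    apply hermitian_dense
    intro H hH
    simp only [LinearMap.comp_apply, AlgHom.toLinearMap_apply]
    rw [hR (h * f) H, map_mul (MvPolynomial.eval _) (L (D h)), hR h H, mul_comm (I _), ← smul_eq_mul (_ : ℂ) (I _), ← map_smul]
    congr 1
    ext U
    rw [hD (h * f) H, ContinuousMap.smul_apply, hD h H, map_mul, smul_eq_mul, mul_comm]
    congr 1
    have := hf (Uᴴ) (by exact (U⁻¹).2) H hH
    rwa [Matrix.conjTranspose_conjTranspose] at this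
  · ext m
    simp only [LinearMap.comp_apply, AlgHom.toLinearMap_apply, hLc, map_one,
      MvPolynomial.coeff_one]
    split_ifs
    · exact hI1
    · exact map_zero I
  · intro n P hP
    have hDP : (D P).IsHomogeneous n := by
      have := hP.aeval (n := 1) g (fun p => MvPolynomial.IsHomogeneous.sum _ _ _ fun d _ =>
        MvPolynomial.IsHomogeneous.sum _ _ _ fun c _ => MvPolynomial.isHomogeneous_C_mul_X _ _)
      simpa using this
    intro m hm
    apply hDP
    intro h0
    apply hm
    simp only [LinearMap.comp_apply, AlgHom.toLinearMap_apply, hLc, h0, map_zero]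

/-- Finite generation of the ring of leptonic flavor invariants
(three-generation case): the ring of flavor invariants of the Hermitian
matrices `{H_l, H_ν, G_{lν}^{(1)}, G_{lν}^{(2)}}` under unitary flavor basis
transformations is a finitely generated ℂ-algebra. -/
theorem flavorInvariants_fg : flavorInvariants.FG := by
  obtain ⟨R, h1, h2, h3, h4⟩ := flavor_reynolds
  exact hilbert_fg_s10 _ R h1 h2 h3 h4
end
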